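/- Let A and B be standard Young tableaux of shapes α and β respectively, and let j ≥ 0 be an integer. Then Σ p^{imaj(τ_{>j})} q^{maj(σ^{>j})}, where the sum is over all pairs (σ,τ) of permutations with Robinson–Schensted insertion tableau P(σ) = A, recording tableau Q(τ) = B, and j ∈ J(σ,τ), equals Σ_{μ ⊢ j} f^{β/μ}(p) f^{α/μ}(q), the sum over partitions μ of j. -/

import Mathlib

open Finset

namespace QT

/-- The major index of a permutation of `Fin n` (sum of descents,
with positions written `1,...,n-1` as in one-line notation). -/
def maj {n : ℕ} (π : Equiv.Perm (Fin n)) : ℕ :=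
  ∑ i ∈ Finset.range n,
    if h : i + 1 < n then
      (if π ⟨i + 1, h⟩ < π ⟨i, by omega⟩ then i + 1 else 0)
    else 0

/-- `imaj π = maj π⁻¹`. -/
def imaj {n : ℕ} (π : Equiv.Perm (Fin n)) : ℕ := maj π⁻¹

/-- The permutation of `Fin k` order-isomorphic to the word `v 0, v 1, ..., v (k-1)`. -/
noncomputable def standardize {n k : ℕ} (v : Fin k → Fin n) (hv : Function.Injective v) :
    Equiv.Perm (Fin k) :=
  Equiv.ofBijective
    (fun i => (Finset.orderIsoOfFin (Finset.image v Finset.univ)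
        (by rw [Finset.card_image_of_injective _ hv, Finset.card_univ, Fintype.card_fin])).symm
        ⟨v i, Finset.mem_image_of_mem v (Finset.mem_univ i)⟩)
    (Finite.injective_iff_bijective.mp (fun i j hij => by
      have h2 := (Finset.orderIsoOfFin _ _).symm.injective hij
      exact hv (congrArg Subtype.val h2)))

/-- `π^{≤k}` : the permutation of `Fin k` order-isomorphic to the first `k` letters of `π`. -/
noncomputable def pInit {n : ℕ} (π : Equiv.Perm (Fin n)) (k : ℕ) (hk : k ≤ n) :
    Equiv.Perm (Fin k) :=
  standardize (fun i => π (Fin.castLE hk i))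
    (fun i j h => Fin.castLE_injective hk (π.injective h))

/-- `π^{>k}` : the permutation of `Fin (n-k)` order-isomorphic to the last `n - k` letters of `π`. -/
noncomputable def pTail {n : ℕ} (π : Equiv.Perm (Fin n)) (k : ℕ) :
    Equiv.Perm (Fin (n - k)) :=
  standardize (fun i => π ⟨k + (i : ℕ), by have := i.isLt; omega⟩)
    (fun i j h => by
      have h2 : k + (i : ℕ) = k + (j : ℕ) := congrArg Fin.val (π.injective h)
      exact Fin.ext (by omega))

/-- `π_{≤k}` : the permutation of `Fin k` order-isomorphic to the subword of `π`
consisting of the `k` smallest values.  (Equivalently `((π⁻¹)^{≤k})⁻¹`.) -/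
noncomputable def vLow {n : ℕ} (π : Equiv.Perm (Fin n)) (k : ℕ) (hk : k ≤ n) :
    Equiv.Perm (Fin k) := (pInit π⁻¹ k hk)⁻¹

/-- `π_{>k}` : the permutation of `Fin (n-k)` order-isomorphic to the subword of `π`
consisting of the values `> k`.  (Equivalently `((π⁻¹)^{>k})⁻¹`.) -/
noncomputable def vHigh {n : ℕ} (π : Equiv.Perm (Fin n)) (k : ℕ) :
    Equiv.Perm (Fin (n - k)) := (pTail π⁻¹ k)⁻¹

/-- The set `I_n` of involutions in `S_n`. -/
def involutions (n : ℕ) : Finset (Equiv.Perm (Fin n)) :=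
  Finset.univ.filter fun π => π * π = 1

-- `I_n(σ) = {π ∈ I_n : π_{≤m} = σ}`.
open scoped Classical in
noncomputable def involutionsC (n : ℕ) {m : ℕ} (σ : Equiv.Perm (Fin m)) :
    Finset (Equiv.Perm (Fin n)) :=
  (involutions n).filter fun π => ∃ h : m ≤ n, vLow π m h = σ

-- `S_n(σ,τ) = {π ∈ S_n : π_{≤a} = σ, π^{≤b} = τ}`.
open scoped Classical in
noncomputable def permsC (n : ℕ) {a b : ℕ} (σ : Equiv.Perm (Fin a)) (τ : Equiv.Perm (Fin b)) :
    Finset (Equiv.Perm (Fin n)) :=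
  Finset.univ.filter fun π => ∃ (ha : a ≤ n) (hb : b ≤ n), vLow π a ha = σ ∧ pInit π b hb = τ

-- The j-set `J(σ) = {j : σ^{≤j} is an involution}`.
open scoped Classical in
noncomputable def jSet {m : ℕ} (σ : Equiv.Perm (Fin m)) : Finset ℕ :=
  (Finset.range (m + 1)).filter fun j => ∃ h : j ≤ m, pInit σ j h * pInit σ j h = 1

-- The j₂-set `J(σ,τ) = {j : σ^{≤j} = τ_{≤j}}`.
open scoped Classical in
noncomputable def j2Set {a b : ℕ} (σ : Equiv.Perm (Fin a)) (τ : Equiv.Perm (Fin b)) :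
    Finset ℕ :=
  (Finset.range (min a b + 1)).filter fun j =>
    ∃ (ha : j ≤ a) (hb : j ≤ b), pInit σ j ha = vLow τ j hb

/-- A set of nonnegative integers is a j₂-set if it is `J(σ,τ)` for some pair of
permutations. -/
def IsJ2Set (S : Finset ℕ) : Prop :=
  ∃ (a b : ℕ) (σ : Equiv.Perm (Fin a)) (τ : Equiv.Perm (Fin b)), S = j2Set σ τ

-- The number of j₂-sets with largest element `n`.
open scoped Classical in
noncomputable def j2count (n : ℕ) : ℕ :=
  ((Finset.range (n + 1)).powerset.filter
    fun S => IsJ2Set S ∧ n ∈ S ∧ ∀ x ∈ S, x ≤ n).card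

/-- `[n]_q = 1 + q + ⋯ + q^{n-1}`. -/
def qInt (q : ℝ) (n : ℕ) : ℝ := ∑ i ∈ Finset.range n, q ^ i

/-- The q-factorial `[n]_q! = ∏_{i=1}^n (1 + q + ⋯ + q^{i-1})`. -/
def qFact (q : ℝ) (n : ℕ) : ℝ := ∏ i ∈ Finset.range n, qInt q (i + 1)

/-- The Gaussian binomial coefficient `[n choose k]_q = [n]_q!/([k]_q! [n-k]_q!)`,
defined via the q-Pascal recursion. -/
def qBinom (q : ℝ) : ℕ → ℕ → ℝ
  | _, 0 => 1
  | 0, _ + 1 => 0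
  | n + 1, k + 1 => qBinom q n k + q ^ (k + 1) * qBinom q n (k + 1)

/-- `t_n(q) = Σ_{π ∈ I_n} q^{maj π}`. -/
noncomputable def tq (q : ℝ) (n : ℕ) : ℝ := ∑ π ∈ involutions n, q ^ maj π

/-- `A_n(p,q) = Σ_{π ∈ S_n} p^{imaj π} q^{maj π}`. -/
noncomputable def Apq (p q : ℝ) (n : ℕ) : ℝ :=
  ∑ π : Equiv.Perm (Fin n), p ^ imaj π * q ^ maj π



/-- The `k × k` square Young diagram. -/
def square (k : ℕ) : YoungDiagram :=
  ⟨Finset.range k ×ˢ Finset.range k, by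
    intro a b hab ha
    rw [Finset.mem_coe, Finset.mem_product] at ha ⊢
    simp only [Finset.mem_range] at ha ⊢
    exact ⟨lt_of_le_of_lt hab.1 ha.1, lt_of_le_of_lt hab.2 ha.2⟩⟩

-- All Young diagrams contained in `l`.
open scoped Classical in
noncomputable def subDiagrams (l : YoungDiagram) : Finset YoungDiagram :=
  (l.cells.powerset.filter fun (s : Finset (ℕ × ℕ)) => IsLowerSet ((s : Set (ℕ × ℕ)))).attach.image
    fun s => YoungDiagram.mk s.1 (by
      have hs := s.2
      rw [Finset.mem_filter] at hs
      exact hs.2)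

/-- All Young diagrams with `k` cells (i.e. partitions of `k`). -/
noncomputable def diagramsOfCard (k : ℕ) : Finset YoungDiagram :=
  (subDiagrams (square k)).filter fun d => d.card = k

/-- A chain of Young diagrams each obtained from the previous by adding one cell.
Such chains of length `n` starting at `μ` and ending at `λ` are exactly the skew standard
Young tableaux of shape `λ/μ` with `n` cells. -/
def IsSYTChain {n : ℕ} (c : Fin (n + 1) → YoungDiagram) : Prop :=
  ∀ i : ℕ, ∀ _h : i < n,
    c ⟨i, by omega⟩ ≤ c ⟨i + 1, by omega⟩ ∧
      (c ⟨i + 1, by omega⟩).card = (c ⟨i, by omega⟩).card + 1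

-- The (skew) standard Young tableaux of shape `λ/μ` and size `n`, encoded as chains.
open scoped Classical in
noncomputable def skewSYT (mu lam : YoungDiagram) (n : ℕ) :
    Finset (Fin (n + 1) → YoungDiagram) :=
  (Fintype.piFinset fun _ : Fin (n + 1) => subDiagrams lam).filter
    fun c => c 0 = mu ∧ c (Fin.last n) = lam ∧ IsSYTChain c

-- `T_n` : all standard Young tableaux of size `n` (encoded as chains starting at `⊥`).
open scoped Classical in
noncomputable def allSYT (n : ℕ) : Finset (Fin (n + 1) → YoungDiagram) :=
  (Fintype.piFinset fun _ : Fin (n + 1) => subDiagrams (square n)).filter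
    fun c => c 0 = ⊥ ∧ IsSYTChain c

/-- The row in which the `(i+1)`-st cell of the chain `c` is added. -/
def rowOfStep {n : ℕ} (c : Fin (n + 1) → YoungDiagram) (i : ℕ) : ℕ :=
  if h : i < n then
    ((c ⟨i + 1, by omega⟩).cells \ (c ⟨i, by omega⟩).cells).sup Prod.fst
  else 0

/-- The major index of a (skew) standard Young tableau, encoded as a chain:
the sum of all `i` such that `i+1` lies in a lower row than `i`. -/
def chainMaj {n : ℕ} (c : Fin (n + 1) → YoungDiagram) : ℕ :=
  ∑ i ∈ Finset.range n,
    if i + 1 < n ∧ rowOfStep c i < rowOfStep c (i + 1) then i + 1 else 0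

/-- `f^{λ/μ}(q) = Σ_{sh(T) = λ/μ} q^{maj T}`, where `n` is the number of cells of `λ/μ`. -/
noncomputable def fSkew (mu lam : YoungDiagram) (n : ℕ) (q : ℝ) : ℝ :=
  ∑ c ∈ skewSYT mu lam n, q ^ chainMaj c

/-- `T_{>m}` : the skew tableau obtained from `T` by removing the entries `≤ m`. -/
def tailChain {n : ℕ} (c : Fin (n + 1) → YoungDiagram) (m : ℕ) :
    Fin (n - m + 1) → YoungDiagram :=
  fun i => c ⟨min (m + (i : ℕ)) n, by omega⟩

/-- `T` contains `A`, i.e. `T_{≤a} = A`. -/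
def containsT {n a : ℕ} (T : Fin (n + 1) → YoungDiagram)
    (A : Fin (a + 1) → YoungDiagram) : Prop :=
  ∀ i : Fin (a + 1), T ⟨min (i : ℕ) n, by omega⟩ = A i

-- `T_n(A,B)` : pairs of standard Young tableaux of the same shape, of size `n`,
-- containing `A` and `B` respectively.
open scoped Classical in
noncomputable def pairSYT (n : ℕ) {a b : ℕ} (A : Fin (a + 1) → YoungDiagram)
    (B : Fin (b + 1) → YoungDiagram) :
    Finset ((Fin (n + 1) → YoungDiagram) × (Fin (n + 1) → YoungDiagram)) :=
  ((allSYT n) ×ˢ (allSYT n)).filter fun PQ =>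
    PQ.1 (Fin.last n) = PQ.2 (Fin.last n) ∧ containsT PQ.1 A ∧ containsT PQ.2 B

/-- The empty standard Young tableau. -/
def emptySYT : Fin (0 + 1) → YoungDiagram := fun _ => ⊥

/-- Schensted row insertion: insert `x` into the row `r`, returning the new row and
the bumped entry (if any). -/
def insertRow : List ℕ → ℕ → List ℕ × Option ℕ
  | [], x => ([x], none)
  | y :: ys, x =>
    if x < y then (x :: ys, some y)
    else
      let p := insertRow ys x
      (y :: p.1, p.2)

/-- Schensted insertion of `x` into a tableau given as a list of rows. -/
def insertTab : List (List ℕ) → ℕ → List (List ℕ)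
  | [], x => [[x]]
  | r :: rs, x =>
    match insertRow r x with
    | (r', none) => r' :: rs
    | (r', some y) => r' :: insertTab rs y

/-- The Robinson–Schensted insertion tableau of a word. -/
def Ptab (w : List ℕ) : List (List ℕ) := w.foldl insertTab []

/-- The Young diagram with row lengths `r` (junk-robust version). -/
def diagramOfRows (r : List ℕ) : YoungDiagram :=
  ⟨(Finset.range r.length ×ˢ Finset.range (r.foldr max 0)).filter
      (fun p => ∀ i ≤ p.1, p.2 < r.getD i 0), by
    intro a b hab ha
    rw [Finset.mem_coe, Finset.mem_filter, Finset.mem_product] at ha ⊢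
    obtain ⟨⟨h1, h2⟩, h3⟩ := ha
    simp only [Finset.mem_range] at h1 h2 ⊢
    refine ⟨⟨lt_of_le_of_lt hab.1 h1, lt_of_le_of_lt hab.2 h2⟩, fun i hi => ?_⟩
    exact lt_of_le_of_lt hab.2 (h3 i (le_trans hi hab.1))⟩

/-- The shape of the Robinson–Schensted insertion tableau of a word. -/
def RSshape (w : List ℕ) : YoungDiagram := diagramOfRows ((Ptab w).map List.length)

/-- The one-line word of a permutation of `Fin a` (with values `0,…,a-1`). -/
def wordOf {a : ℕ} (σ : Equiv.Perm (Fin a)) : List ℕ :=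
  (List.finRange a).map fun i => (σ i : ℕ)

/-- The chain encoding of the Robinson–Schensted insertion tableau `P(σ)`:
its `i`-th diagram is the shape of the subtableau of `P(σ)` with entries `≤ i`,
which equals the RS-shape of the subword of `σ` with values `≤ i`. -/
def Pchain {a : ℕ} (σ : Equiv.Perm (Fin a)) : Fin (a + 1) → YoungDiagram :=
  fun i => RSshape ((wordOf σ).filter fun x => x < (i : ℕ))

/-- The chain encoding of the Robinson–Schensted recording tableau `Q(σ)`:
its `i`-th diagram is the shape of the subtableau of `Q(σ)` with entries `≤ i`,
which equals the RS-shape of the prefix of `σ` of length `i`. -/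
def Qchain {a : ℕ} (σ : Equiv.Perm (Fin a)) : Fin (a + 1) → YoungDiagram :=
  fun i => RSshape ((wordOf σ).take (i : ℕ))

/-- The row-length function `f` with one cell added to row `r`. -/
def addCell (f : ℕ → ℕ) (r : ℕ) : ℕ → ℕ := fun t => if t = r then f t + 1 else f t

/-- The row in which the shapes `g k` and `growInsert g x k` differ, for `x < k`. -/
def growRow (g : ℕ → ℕ → ℕ) (x : ℕ) : ℕ → ℕ
  | 0 => 0
  | k + 1 =>
    if k ≤ x then 0
    else if g k (growRow g x k) < g (k + 1) (growRow g x k) then growRow g x k + 1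
    else growRow g x k

/-- Effect of the insertion of `x` on the shapes `g k` of the subtableaux with entries `< k`. -/
def growInsert (g : ℕ → ℕ → ℕ) (x k : ℕ) : ℕ → ℕ :=
  if k ≤ x then g k else addCell (g k) (growRow g x k)

/-- The row lengths of the subtableau with entries `< k` of the insertion tableau of `w`. -/
def grow (w : List ℕ) : ℕ → ℕ → ℕ := w.foldl growInsert 0

/-- The number of entries `< k` in row `r` of `T`. -/
def entryCount (T : List (List ℕ)) (k r : ℕ) : ℕ := (T.getD r []).countP (· < k)

lemma insertRow_spec (R : List ℕ) (y : ℕ) (hR : R.Pairwise (· ≤ ·)) :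
    ((insertRow R y).1.Pairwise (· ≤ ·)) ∧
    ((insertRow R y = (R ++ [y], none) ∧ ∀ u ∈ R, u ≤ y) ∨
    ∃ R₁ z R₂, R = R₁ ++ z :: R₂ ∧ insertRow R y = (R₁ ++ y :: R₂, some z) ∧
      (∀ u ∈ R₁, u ≤ y) ∧ y < z ∧ ∀ u ∈ R₂, z ≤ u) := by
  induction R with
  | nil => simp [insertRow]
  | cons u R ih =>
    rw [List.pairwise_cons] at hR
    obtain ⟨hs, ih⟩ := ih hR.2
    by_cases h : y < u
    · refine ⟨?_, Or.inr ⟨[], u, R, rfl, by simp [insertRow, h], by simp, h, hR.1⟩⟩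
      simp only [insertRow, h, if_true, List.pairwise_cons]
      exact ⟨fun v hv => h.le.trans (hR.1 v hv), hR.2⟩
    · push Not at h
      have hu : insertRow (u :: R) y = (u :: (insertRow R y).1, (insertRow R y).2) := by
        simp [insertRow, h.not_gt]
      rcases ih with ⟨h1, h2⟩ | ⟨R₁, z, R₂, h1, h2, h3, h4, h5⟩
      · refine ⟨?_, Or.inl ⟨?_, ?_⟩⟩
        · rw [hu, List.pairwise_cons]
          refine ⟨fun v hv => ?_, hs⟩
          rw [h1] at hv
          simp only [List.mem_append, List.mem_singleton] at hv
          rcases hv with hv | rfl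
          exacts [hR.1 v hv, h]
        · rw [hu, h1]; rfl
        · simpa [h] using h2
      · refine ⟨?_, Or.inr ⟨u :: R₁, z, R₂, by rw [h1]; rfl, by rw [hu, h2]; rfl, ?_, h4, h5⟩⟩
        · rw [hu, List.pairwise_cons]
          refine ⟨fun v hv => ?_, hs⟩
          rw [h2] at hv
          simp only [List.mem_append, List.mem_cons] at hv
          subst h1
          rcases hv with hv | rfl | hv
          · exact hR.1 v (by simp [hv])
          · exact h
          · exact hR.1 v (by simp [hv])
        · simpa [h] using h3

lemma insertTab_pairwise (T : List (List ℕ)) (y : ℕ) (hT : ∀ R ∈ T, R.Pairwise (· ≤ ·)) :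
    ∀ R ∈ insertTab T y, R.Pairwise (· ≤ ·) := by
  induction T generalizing y with
  | nil => simp [insertTab]
  | cons R T ih =>
    obtain ⟨hs, h⟩ := insertRow_spec R y (hT R (by simp))
    have hT' : ∀ R ∈ T, R.Pairwise (· ≤ ·) := fun R hR => hT R (by simp [hR])
    rcases h with ⟨h1, -⟩ | ⟨R₁, z, R₂, -, h2, -⟩
    · rw [h1] at hs
      simpa [insertTab, h1] using ⟨hs, hT'⟩
    · rw [h2] at hs
      simpa [insertTab, h2] using ⟨hs, ih z hT'⟩

lemma countP_lt_succ (R : List ℕ) (k : ℕ) :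
    R.countP (· < k) < R.countP (· < k + 1) ↔ k ∈ R := by
  induction R with
  | nil => simp
  | cons u R ih =>
    have hle : R.countP (· < k) ≤ R.countP (· < k + 1) :=
      List.countP_mono_left (by grind)
    simp only [List.countP_cons, List.mem_cons, decide_eq_true_eq]
    grind

lemma entryCount_cons_zero (R : List ℕ) (T : List (List ℕ)) (k : ℕ) :
    entryCount (R :: T) k 0 = R.countP (· < k) := rfl

lemma entryCount_cons_succ (R : List ℕ) (T : List (List ℕ)) (k r : ℕ) :
    entryCount (R :: T) k (r + 1) = entryCount T k r := rfl

lemma growRow_entryCount_nil (y k : ℕ) : growRow (entryCount []) y k = 0 := by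
  induction k with
  | zero => rfl
  | succ k ih => simp [growRow, ih, entryCount]

lemma growRow_entryCount_of_le (R : List ℕ) (T : List (List ℕ)) (y k : ℕ)
    (h : ∀ u ∈ R, y < u → k ≤ u) : growRow (entryCount (R :: T)) y k = 0 := by
  induction k with
  | zero => rfl
  | succ k ih =>
    have hk := ih fun u hu hy => (h u hu hy).trans' (by omega)
    rw [growRow, hk]
    split_ifs with h1 h2
    · rfl
    · rw [entryCount_cons_zero, entryCount_cons_zero, countP_lt_succ] at h2
      have := h k h2 (by omega)
      omega
    · rfl

lemma growRow_entryCount_cons (R : List ℕ) (T : List (List ℕ)) {y z : ℕ} (hz : z ∈ R)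
    (hyz : y < z) (h : ∀ u ∈ R, y < u → z ≤ u) (k : ℕ) (hk : z < k) :
    growRow (entryCount (R :: T)) y k = growRow (entryCount T) z k + 1 := by
  induction k, hk using Nat.le_induction with
  | base =>
    rw [growRow, growRow, growRow_entryCount_of_le R T y z h, entryCount_cons_zero,
      entryCount_cons_zero, if_neg (by omega), if_pos ((countP_lt_succ R z).2 hz), if_pos le_rfl]
  | succ k hk ih =>
    rw [growRow, growRow, ih, entryCount_cons_succ, entryCount_cons_succ,
      if_neg (show ¬k ≤ y by omega), if_neg (show ¬k ≤ z by omega)]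
    split_ifs <;> rfl

lemma entryCount_insertTab (T : List (List ℕ)) (y : ℕ) (hT : ∀ R ∈ T, R.Pairwise (· ≤ ·)) :
    entryCount (insertTab T y) = growInsert (entryCount T) y := by
  induction T generalizing y with
  | nil =>
    funext k r
    rw [growInsert, growRow_entryCount_nil]
    rcases r with _ | r
    · by_cases h : k ≤ y <;> simp [insertTab, entryCount, addCell, h, not_le.1]
    · by_cases h : k ≤ y <;> simp [insertTab, entryCount, addCell, h]
  | cons R T ih =>
    obtain ⟨-, h⟩ := insertRow_spec R y (hT R (by simp))
    have hT' : ∀ R ∈ T, R.Pairwise (· ≤ ·) := fun R hR => hT R (by simp [hR])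
    rcases h with ⟨h1, h2⟩ | ⟨R₁, z, R₂, hR, h2, h3, h4, h5⟩
    · have hi : insertTab (R :: T) y = (R ++ [y]) :: T := by simp [insertTab, h1]
      funext k r
      rw [hi, growInsert, growRow_entryCount_of_le _ _ _ _ fun u hu hy =>
        absurd (h2 u hu) hy.not_ge]
      rcases r with _ | r
      · rw [entryCount_cons_zero]
        by_cases h : k ≤ y
        · simp [entryCount_cons_zero, h]
        · simp [entryCount_cons_zero, addCell, h, not_le.1]
      · rw [entryCount_cons_succ]
        by_cases h : k ≤ y <;> simp [entryCount_cons_succ, addCell, h]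
    · have hi : insertTab (R :: T) y = (R₁ ++ y :: R₂) :: insertTab T z := by
        simp [insertTab, h2]
      have hz : z ∈ R := by simp [hR]
      have hmin : ∀ u ∈ R, y < u → z ≤ u := by
        intro u hu hy
        rw [hR, List.mem_append, List.mem_cons] at hu
        rcases hu with hu | rfl | hu
        · exact absurd (h3 u hu) hy.not_ge
        · exact le_rfl
        · exact h5 u hu
      funext k r
      rw [hi, growInsert]
      rcases le_or_gt k z with hkz | hkz
      · rw [growRow_entryCount_of_le R T y k fun u hu hy => hkz.trans (hmin u hu hy)]
        rcases r with _ | r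
        · rw [entryCount_cons_zero]
          by_cases h : k ≤ y
          · simp [entryCount_cons_zero, h, hR, hkz.not_gt]
          · simp [entryCount_cons_zero, addCell, h, hR, hkz.not_gt, not_le.1 h]
            omega
        · rw [entryCount_cons_succ, ih z hT']
          by_cases h : k ≤ y <;> simp [entryCount_cons_succ, addCell, h, growInsert, hkz]
      · rw [growRow_entryCount_cons R T hz h4 hmin k hkz, if_neg (by omega)]
        rcases r with _ | r
        · simp [entryCount_cons_zero, addCell, hR, hkz, h4.trans hkz]
        · rw [entryCount_cons_succ, ih z hT']
          simp [entryCount_cons_succ, addCell, growInsert, hkz.not_ge]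

lemma Ptab_append_singleton (w : List ℕ) (x : ℕ) :
    Ptab (w ++ [x]) = insertTab (Ptab w) x := by
  simp [Ptab]

lemma Ptab_pairwise (w : List ℕ) : ∀ R ∈ Ptab w, R.Pairwise (· ≤ ·) := by
  induction w using List.reverseRecOn with
  | nil => simp [Ptab]
  | append_singleton w x ih => rw [Ptab_append_singleton]; exact insertTab_pairwise _ _ ih

lemma grow_append_singleton (w : List ℕ) (x : ℕ) :
    grow (w ++ [x]) = growInsert (grow w) x := by
  simp [grow]

lemma entryCount_Ptab (w : List ℕ) : entryCount (Ptab w) = grow w := by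
  induction w using List.reverseRecOn with
  | nil => funext k r; simp [Ptab, entryCount, grow]
  | append_singleton w x ih =>
    rw [Ptab_append_singleton, grow_append_singleton, entryCount_insertTab _ _ (Ptab_pairwise w),
      ih]

/-- The shapes `g k` of a standard filling restricted to its entries `< k`, as row lengths. -/
structure IsGrowth (g : ℕ → ℕ → ℕ) : Prop where
  zero : g 0 = 0
  antitone : ∀ k, Antitone (g k)
  step : ∀ k, g (k + 1) = g k ∨ ∃ s, g (k + 1) = addCell (g k) s

lemma addCell_ne (f : ℕ → ℕ) (r : ℕ) : addCell f r ≠ f := fun h => by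
  simpa [addCell] using congrFun h r

lemma addCell_inj {f : ℕ → ℕ} {r s : ℕ} : addCell f r = addCell f s ↔ r = s := by
  refine ⟨fun h => ?_, fun h => h ▸ rfl⟩
  by_contra hrs
  simpa [addCell, hrs] using congrFun h r

lemma addCell_comm (f : ℕ → ℕ) (r s : ℕ) :
    addCell (addCell f r) s = addCell (addCell f s) r := by
  funext t
  simp only [addCell]
  split_ifs <;> rfl

lemma addCell_left_inj {f g : ℕ → ℕ} {r : ℕ} : addCell f r = addCell g r ↔ f = g := by
  refine ⟨fun h => ?_, fun h => h ▸ rfl⟩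
  funext t
  have := congrFun h t
  simp only [addCell] at this
  split_ifs at this <;> omega

lemma antitone_addCell_addCell {f : ℕ → ℕ} {r s : ℕ} (hr : Antitone (addCell f r))
    (hs : Antitone (addCell f s)) (hrs : r ≠ s) : Antitone (addCell (addCell f r) s) := by
  refine antitone_nat_of_succ_le fun t => ?_
  have h1 := hr (Nat.le_succ t)
  have h2 := hs (Nat.le_succ t)
  simp only [addCell, Nat.succ_eq_add_one] at *
  grind

lemma antitone_addCell_succ {f : ℕ → ℕ} {r : ℕ} (hf : Antitone f) (hr : Antitone (addCell f r)) :
    Antitone (addCell (addCell f r) (r + 1)) := by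
  refine antitone_nat_of_succ_le fun t => ?_
  have h1 := hr (Nat.le_succ t)
  have h2 := hf (Nat.le_succ t)
  simp only [addCell, Nat.succ_eq_add_one] at *
  grind

lemma antitone_addCell_zero {f : ℕ → ℕ} (hf : Antitone f) : Antitone (addCell f 0) := by
  refine antitone_nat_of_succ_le fun t => ?_
  have h2 := hf (Nat.le_succ t)
  simp only [addCell, Nat.succ_eq_add_one] at *
  grind

lemma growRow_of_le (g : ℕ → ℕ → ℕ) {x k : ℕ} (h : k ≤ x) : growRow g x k = 0 := by
  cases k with
  | zero => rfl
  | succ k => rw [growRow, if_pos (by omega)]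

lemma growRow_succ_of_lt (g : ℕ → ℕ → ℕ) {x k : ℕ} (h : x < k) :
    growRow g x (k + 1) = if g k (growRow g x k) < g (k + 1) (growRow g x k) then
      growRow g x k + 1 else growRow g x k := by
  rw [growRow, if_neg (by omega)]

lemma growRow_self_succ (g : ℕ → ℕ → ℕ) (x : ℕ) : growRow g x (x + 1) = 0 := by
  rw [growRow, if_pos le_rfl]

lemma growRow_succ_of_eq {g : ℕ → ℕ → ℕ} (x : ℕ) {k : ℕ} (h : g (k + 1) = g k) :
    growRow g x (k + 1) = growRow g x k := by
  rw [growRow, h]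
  split_ifs with h1 h2
  · rw [growRow_of_le g h1]
  · omega
  · rfl

lemma growRow_succ_of_eq_row {g : ℕ → ℕ → ℕ} {x k : ℕ} (hk : x < k)
    (h : g (k + 1) = addCell (g k) (growRow g x k)) :
    growRow g x (k + 1) = growRow g x k + 1 := by
  rw [growRow, h, if_neg (by omega), if_pos (by simp [addCell])]

lemma growRow_succ_of_ne_row {g : ℕ → ℕ → ℕ} {x k s : ℕ}
    (h : g (k + 1) = addCell (g k) s) (hs : s ≠ growRow g x k) :
    growRow g x (k + 1) = growRow g x k := by
  rw [growRow, h]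
  split_ifs with h1 h2
  · rw [growRow_of_le g h1]
  · simp [addCell, hs.symm] at h2
  · rfl

/-- Fomin's local rule for a cell of a growth diagram with south-west corner `ρ`, south-east
corner `μ`, north-west corner `ν` and north-east corner `l`; `m` says that the cell is marked. -/
inductive LocalRule : Prop → (ℕ → ℕ) → (ℕ → ℕ) → (ℕ → ℕ) → (ℕ → ℕ) → Prop
  | mark (m : Prop) (ρ) (hm : m) : LocalRule m ρ ρ ρ (addCell ρ 0)
  | const (m : Prop) (ρ) (hm : ¬m) : LocalRule m ρ ρ ρ ρ
  | up (m : Prop) (ρ s) (hm : ¬m) : LocalRule m ρ ρ (addCell ρ s) (addCell ρ s)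
  | right (m : Prop) (ρ r) (hm : ¬m) : LocalRule m ρ (addCell ρ r) ρ (addCell ρ r)
  | union (m : Prop) (ρ r s) (hm : ¬m) (hrs : r ≠ s) :
    LocalRule m ρ (addCell ρ r) (addCell ρ s) (addCell (addCell ρ r) s)
  | bump (m : Prop) (ρ r) (hm : ¬m) :
    LocalRule m ρ (addCell ρ r) (addCell ρ r) (addCell (addCell ρ r) (r + 1))

namespace LocalRule

variable {m m' : Prop} {ρ ρ' μ ν l l' : ℕ → ℕ}

lemma symm (h : LocalRule m ρ μ ν l) : LocalRule m ρ ν μ l := by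
  cases h with
  | mark hm => exact .mark m ρ hm
  | const hm => exact .const m ρ hm
  | up s hm => exact .right m ρ s hm
  | right r hm => exact .up m ρ r hm
  | union r s hm hrs => rw [addCell_comm]; exact .union m ρ s r hm hrs.symm
  | bump r hm => exact .bump m ρ r hm

open scoped Classical in
lemma north_east (h : LocalRule m ρ μ ν l) :
    l = if m then addCell ρ 0 else if μ = ν then
      fun t => μ t + if t ≠ 0 ∧ ρ (t - 1) ≠ μ (t - 1) then 1 else 0 else fun t => μ t + ν t - ρ t := by
  cases h with
  | mark hm => simp [hm]
  | const hm => simp [hm]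
  | up s hm => simp [hm, (addCell_ne ρ s).symm]
  | right r hm => simp [hm, addCell_ne]
  | union r s hm hrs =>
    rw [if_neg hm, if_neg (mt addCell_inj.1 hrs)]
    funext t
    simp only [addCell]
    split_ifs <;> omega
  | bump r hm =>
    rw [if_neg hm, if_pos rfl]
    funext t
    simp only [addCell]
    rcases t with _ | t <;> grind

open scoped Classical in
lemma south_west (h : LocalRule m ρ μ ν l) :
    ρ = if μ = ν then fun t => μ t - if l (t + 1) ≠ ν (t + 1) then 1 else 0
      else fun t => μ t + ν t - l t := by
  cases h with
  | mark hm => simp [addCell]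
  | const hm => simp
  | up s hm => simp [(addCell_ne ρ s).symm]
  | right r hm => simp [addCell_ne]
  | union r s hm hrs =>
    rw [if_neg (mt addCell_inj.1 hrs)]
    funext t
    simp only [addCell]
    grind
  | bump r hm =>
    rw [if_pos rfl]
    funext t
    simp only [addCell]
    grind

lemma mark_iff (h : LocalRule m ρ μ ν l) : m ↔ μ = ν ∧ l 0 ≠ ν 0 := by
  cases h with
  | mark hm => simp [hm, addCell]
  | const hm => simp [hm]
  | up s hm => simp [hm]
  | right r hm => simp [hm, addCell_ne]
  | union r s hm hrs => simp [hm, addCell_inj, hrs]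
  | bump r hm => simp [hm, addCell]

lemma north_east_unique (h : LocalRule m ρ μ ν l) (h' : LocalRule m' ρ μ ν l') (hm : m ↔ m') :
    l = l' := by
  have hm := propext hm
  subst hm
  rw [h.north_east, h'.north_east]

lemma south_west_unique (h : LocalRule m ρ μ ν l) (h' : LocalRule m' ρ' μ ν l) :
    ρ = ρ' ∧ (m ↔ m') :=
  ⟨by rw [h.south_west, h'.south_west], by rw [h.mark_iff, h'.mark_iff]⟩

lemma antitone (h : LocalRule m ρ μ ν l) (hρ : Antitone ρ) (hμ : Antitone μ) (hν : Antitone ν) :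
    Antitone l := by
  cases h with
  | mark hm => exact antitone_addCell_zero hρ
  | const hm => exact hρ
  | up s hm => exact hν
  | right r hm => exact hμ
  | union r s hm hrs => exact antitone_addCell_addCell hμ hν hrs
  | bump r hm => exact antitone_addCell_succ hρ hμ

lemma up_step (h : LocalRule m ρ μ ν l) : l = μ ∨ ∃ s, l = addCell μ s := by
  cases h with
  | mark hm => exact .inr ⟨_, rfl⟩
  | const hm => exact .inl rfl
  | up s hm => exact .inr ⟨_, rfl⟩
  | right r hm => exact .inl rfl
  | union r s hm hrs => exact .inr ⟨_, rfl⟩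
  | bump r hm => exact .inr ⟨_, rfl⟩

lemma eq_iff (h : LocalRule m ρ μ ν l) : l = μ ↔ ¬m ∧ ν = ρ := by
  cases h with
  | mark hm => simp [hm, addCell_ne]
  | const hm => simp [hm]
  | up s hm => simp [addCell_ne]
  | right r hm => simp [hm]
  | union r s hm hrs => simp [addCell_ne]
  | bump r hm => simp [addCell_ne]

end LocalRule

lemma IsGrowth.localRule {g : ℕ → ℕ → ℕ} (hg : IsGrowth g) {x : ℕ} (hx : g (x + 1) = g x)
    (k : ℕ) : LocalRule (x = k) (g k) (growInsert g x k) (g (k + 1)) (growInsert g x (k + 1)) := by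
  rcases lt_trichotomy k x with h | rfl | h
  · rw [growInsert, growInsert, if_pos h.le, if_pos (by omega)]
    rcases hg.step k with hs | ⟨s, hs⟩ <;> rw [hs]
    exacts [.const _ _ (by omega), .up _ _ _ (by omega)]
  · rw [growInsert, growInsert, if_pos le_rfl, if_neg (by omega), growRow_self_succ, hx]
    exact .mark _ _ rfl
  · rw [growInsert, growInsert, if_neg (by omega), if_neg (by omega)]
    rcases hg.step k with hs | ⟨s, hs⟩
    · rw [growRow_succ_of_eq x hs, hs]
      exact .right _ _ _ (by omega)
    · by_cases hsr : s = growRow g x k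
      · subst hsr
        rw [growRow_succ_of_eq_row h hs, hs]
        exact .bump _ _ _ (by omega)
      · rw [growRow_succ_of_ne_row hs hsr, hs, addCell_comm]
        exact .union _ _ _ _ (by omega) (Ne.symm hsr)

lemma IsGrowth.growInsert {g : ℕ → ℕ → ℕ} (hg : IsGrowth g) {x : ℕ} (hx : g (x + 1) = g x) :
    IsGrowth (growInsert g x) := by
  have h0 : QT.growInsert g x 0 = 0 := by rw [QT.growInsert, if_pos (Nat.zero_le x), hg.zero]
  refine ⟨h0, fun k => ?_, fun k => (hg.localRule hx k).up_step⟩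
  induction k with
  | zero => rw [h0]; exact fun _ _ _ => le_rfl
  | succ k ih => exact (hg.localRule hx k).antitone (hg.antitone k) ih (hg.antitone (k + 1))

lemma isGrowth_grow_and (w : List ℕ) (hw : w.Nodup) :
    IsGrowth (grow w) ∧ ∀ k, grow w (k + 1) = grow w k ↔ k ∉ w := by
  induction w using List.reverseRecOn with
  | nil =>
    exact ⟨⟨rfl, fun k _ _ _ => le_rfl, fun k => .inl rfl⟩, fun k => by simp [grow]⟩
  | append_singleton w x ih =>
    rw [List.nodup_append] at hw
    obtain ⟨hg, hk⟩ := ih hw.1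
    have hx : grow w (x + 1) = grow w x := (hk x).2 fun h => hw.2.2 x h x (by simp) rfl
    rw [grow_append_singleton]
    refine ⟨hg.growInsert hx, fun k => ?_⟩
    rw [(hg.localRule hx k).eq_iff, hk]
    simp only [List.mem_append, List.mem_singleton]
    grind

lemma isGrowth_grow {w : List ℕ} (hw : w.Nodup) : IsGrowth (grow w) := (isGrowth_grow_and w hw).1

lemma grow_succ_eq_iff {w : List ℕ} (hw : w.Nodup) {k : ℕ} :
    grow w (k + 1) = grow w k ↔ k ∉ w := (isGrowth_grow_and w hw).2 k

lemma growRow_growInsert_le {g : ℕ → ℕ → ℕ} {x y : ℕ} (hg : IsGrowth g)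
    (hxy : x < y) {k : ℕ} (hk : y < k) : growRow (growInsert g x) y k ≤ growRow g x k := by
  induction k, hk using Nat.le_induction with
  | base => rw [growRow_self_succ]; exact Nat.zero_le _
  | succ k hk ih =>
    have h1 : growInsert g x k = addCell (g k) (growRow g x k) := if_neg (by omega)
    have h2 : growInsert g x (k + 1) = addCell (g (k + 1)) (growRow g x (k + 1)) :=
      if_neg (by omega)
    have hs := hg.step k
    rw [growRow_succ_of_lt _ hk, h1, h2, growRow_succ_of_lt g (hxy.trans hk)]
    rcases hs with hs | ⟨s, hs⟩ <;> simp only [hs, addCell] <;> grind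

lemma lt_growRow_growInsert {g : ℕ → ℕ → ℕ} {x y : ℕ} (hg : IsGrowth g)
    (hx : g (x + 1) = g x) (hxy : y < x) {k : ℕ} (hk : x < k) :
    growRow g x k < growRow (growInsert g x) y k := by
  induction k, hk using Nat.le_induction with
  | base =>
    have h1 : growInsert g x x = g x := if_pos le_rfl
    have h2 : growInsert g x (x + 1) = addCell (g (x + 1)) (growRow g x (x + 1)) :=
      if_neg (by omega)
    rw [growRow_self_succ] at h2 ⊢
    rw [growRow_succ_of_lt _ hxy, h1, h2, hx]
    simp only [addCell]
    grind
  | succ k hk ih =>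
    have h1 : growInsert g x k = addCell (g k) (growRow g x k) := if_neg (by omega)
    have h2 : growInsert g x (k + 1) = addCell (g (k + 1)) (growRow g x (k + 1)) :=
      if_neg (by omega)
    have hs := hg.step k
    rw [growRow_succ_of_lt _ (hxy.trans hk), h1, h2, growRow_succ_of_lt g hk]
    rcases hs with hs | ⟨s, hs⟩ <;> simp only [hs, addCell] <;> grind

lemma growRow_congr {g g' : ℕ → ℕ → ℕ} (x : ℕ) {k : ℕ} (h : ∀ j ≤ k, g j = g' j) :
    growRow g x k = growRow g' x k := by
  induction k with
  | zero => rfl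
  | succ k ih =>
    rw [growRow, growRow, ih fun j hj => h j (by omega), h k (by omega), h (k + 1) le_rfl]

lemma growInsert_congr {g g' : ℕ → ℕ → ℕ} (x : ℕ) {k : ℕ} (h : ∀ j ≤ k, g j = g' j) :
    growInsert g x k = growInsert g' x k := by
  rw [growInsert, growInsert, growRow_congr x h, h k le_rfl]

lemma grow_filter (w : List ℕ) (k : ℕ) {j : ℕ} (hj : j ≤ k) :
    grow (w.filter fun x => x < k) j = grow w j := by
  induction w using List.reverseRecOn generalizing j with
  | nil => rfl
  | append_singleton w x ih =>
    rw [List.filter_append, grow_append_singleton]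
    by_cases hx : x < k
    · rw [List.filter_singleton, decide_eq_true hx]
      exact (congrFun (grow_append_singleton _ _) j).trans
        (growInsert_congr x fun i hi => ih (hi.trans hj))
    · rw [List.filter_singleton, decide_eq_false hx, growInsert, if_pos (by omega)]
      simpa using ih hj

lemma getD_le_foldr_max (l : List ℕ) (i : ℕ) : l.getD i 0 ≤ l.foldr max 0 := by
  induction l generalizing i with
  | nil => simp
  | cons u l ih => cases i with
    | zero => simp
    | succ i => simpa using Or.inr (ih i)

lemma rowLen_diagramOfRows (l : List ℕ) (hl : Antitone fun i => l.getD i 0) :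
    (diagramOfRows l).rowLen = fun i => l.getD i 0 := by
  funext i
  refine eq_of_forall_lt_iff fun j => ?_
  rw [← YoungDiagram.mem_iff_lt_rowLen, ← YoungDiagram.mem_cells, diagramOfRows,
    Finset.mem_filter, Finset.mem_product, Finset.mem_range, Finset.mem_range]
  refine ⟨fun h => h.2 i le_rfl, fun h => ⟨⟨?_, h.trans_le (getD_le_foldr_max l i)⟩,
    fun i' hi' => h.trans_le (hl hi')⟩⟩
  by_contra hi
  rw [List.getD_eq_default _ _ (not_lt.1 hi)] at h
  omega

lemma rowLen_RSshape {w : List ℕ} (hw : w.Nodup) {N : ℕ} (hN : ∀ u ∈ w, u < N) :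
    (RSshape w).rowLen = grow w N := by
  have hlen : (fun r => ((Ptab w).map List.length).getD r 0) = grow w N := by
    funext r
    rw [← entryCount_Ptab, entryCount]
    have h0 : ((Ptab w).map List.length).getD r 0 = ((Ptab w).getD r []).length := by
      simp only [List.getD_eq_getElem?_getD, List.getElem?_map]
      cases (Ptab w)[r]? <;> rfl
    rw [h0, eq_comm, List.countP_eq_length]
    intro k hk
    rw [← countP_lt_succ] at hk
    have hkw : k ∈ w := by
      by_contra hkw
      rw [← grow_succ_eq_iff hw, ← entryCount_Ptab] at hkw
      exact hk.ne' (congrFun hkw r)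
    simpa using hN k hkw
  rw [RSshape, rowLen_diagramOfRows _ (by rw [hlen]; exact (isGrowth_grow hw).antitone N), hlen]

lemma rowLen_injective : Function.Injective YoungDiagram.rowLen := by
  intro d e h
  ext ⟨i, j⟩
  rw [YoungDiagram.mem_cells, YoungDiagram.mem_cells, YoungDiagram.mem_iff_lt_rowLen,
    YoungDiagram.mem_iff_lt_rowLen, h]

section Word

variable {n : ℕ} (σ : Equiv.Perm (Fin n))

lemma length_wordOf : (wordOf σ).length = n := by simp [wordOf]

lemma getElem_wordOf (i : ℕ) (hi : i < (wordOf σ).length) :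
    (wordOf σ)[i] = σ ⟨i, by simpa [length_wordOf] using hi⟩ := by
  simp [wordOf]

lemma nodup_wordOf : (wordOf σ).Nodup :=
  (List.nodup_finRange n).map (Fin.val_injective.comp σ.injective)

lemma lt_of_mem_wordOf {u : ℕ} (hu : u ∈ wordOf σ) : u < n := by
  simp only [wordOf, List.mem_map] at hu
  obtain ⟨i, -, rfl⟩ := hu
  exact (σ i).isLt

lemma rowLen_Pchain (i : Fin (n + 1)) : (Pchain σ i).rowLen = grow (wordOf σ) i := by
  rw [Pchain, rowLen_RSshape ((nodup_wordOf σ).filter _) (N := i) (by simp),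
    grow_filter _ _ le_rfl]

lemma rowLen_Qchain (i : Fin (n + 1)) :
    (Qchain σ i).rowLen = grow ((wordOf σ).take i) n :=
  rowLen_RSshape (nodup_wordOf σ |>.take) fun _ hu => lt_of_mem_wordOf σ (List.mem_of_mem_take hu)

end Word

lemma grow_localRule {w : List ℕ} (hw : w.Nodup) {i : ℕ} (hi : i < w.length) (k : ℕ) :
    LocalRule (w[i] = k) (grow (w.take i) k) (grow (w.take (i + 1)) k)
      (grow (w.take i) (k + 1)) (grow (w.take (i + 1)) (k + 1)) := by
  have hx : w[i] ∉ w.take i := by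
    have : (w.take (i + 1)).Nodup := hw.take
    rw [← List.take_append_getElem hi, List.nodup_append] at this
    exact fun h => this.2.2 _ h _ (by simp) rfl
  have h := hw.take (i := i)
  rw [← List.take_append_getElem hi, grow_append_singleton]
  exact (isGrowth_grow h).localRule ((grow_succ_eq_iff h).2 hx) k

lemma grow_take_inv {n : ℕ} (σ : Equiv.Perm (Fin n)) {i k : ℕ} (hi : i ≤ n) (hk : k ≤ n) :
    grow ((wordOf σ).take i) k = grow ((wordOf σ⁻¹).take k) i := by
  induction i generalizing k with
  | zero => rw [(isGrowth_grow ((nodup_wordOf σ⁻¹).take)).zero]; rfl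
  | succ i ihi =>
    induction k with
    | zero => rw [(isGrowth_grow ((nodup_wordOf σ).take)).zero]; rfl
    | succ k ihk =>
      have hi' : i < (wordOf σ).length := by rw [length_wordOf]; omega
      have hk' : k < (wordOf σ⁻¹).length := by rw [length_wordOf]; omega
      have h1 := grow_localRule (nodup_wordOf σ) hi' k
      have h2 := (grow_localRule (nodup_wordOf σ⁻¹) hk' i).symm
      rw [← ihi (by omega) (by omega), ← ihi (by omega) (by omega), ← ihk (by omega)] at h2
      refine h1.north_east_unique h2 ?_
      rw [getElem_wordOf, getElem_wordOf]
      have e1 : (σ ⟨i, by omega⟩ : ℕ) = k ↔ σ ⟨i, by omega⟩ = ⟨k, by omega⟩ := by rw [Fin.ext_iff]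
      have e2 : (σ⁻¹ ⟨k, by omega⟩ : ℕ) = i ↔ σ⁻¹ ⟨k, by omega⟩ = ⟨i, by omega⟩ := by
        rw [Fin.ext_iff]
      rw [e1, e2, Equiv.Perm.inv_eq_iff_eq, eq_comm]

lemma Pchain_inv {n : ℕ} (σ : Equiv.Perm (Fin n)) : Pchain σ⁻¹ = Qchain σ := by
  funext i
  apply rowLen_injective
  have hi := i.is_le
  rw [rowLen_Pchain, rowLen_Qchain, grow_take_inv σ hi le_rfl,
    List.take_of_length_le (length_wordOf _).le]

lemma grow_take_unique {w w' : List ℕ} (hw : w.Nodup) (hw' : w'.Nodup)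
    (hlen : w.length = w'.length) {N j : ℕ} (hright : ∀ k ≤ N, grow w k = grow w' k)
    (htop : ∀ i, j ≤ i → i ≤ w.length → grow (w.take i) N = grow (w'.take i) N) :
    (∀ i, j ≤ i → i ≤ w.length → ∀ k ≤ N, grow (w.take i) k = grow (w'.take i) k) ∧
    ∀ i (hi : i < w.length), j ≤ i → ∀ k < N, w[i] = k ↔ w'[i] = k := by
  have key : ∀ i (hi : i < w.length), j ≤ i →
      (∀ k ≤ N, grow (w.take (i + 1)) k = grow (w'.take (i + 1)) k) →
      ∀ k (hk : k ≤ N), grow (w.take i) k = grow (w'.take i) k ∧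
        ∀ k < N, grow (w.take i) (k + 1) = grow (w'.take i) (k + 1) → (w[i] = k ↔ w'[i] = k) := by
    intro i hi hj h
    have loc : ∀ k < N, grow (w.take i) (k + 1) = grow (w'.take i) (k + 1) →
        grow (w.take i) k = grow (w'.take i) k ∧ (w[i] = k ↔ w'[i] = k) := by
      intro k hk e
      have h1 := grow_localRule hw hi k
      have h2 := grow_localRule hw' (hlen ▸ hi) k
      rw [← e, ← h k hk.le, ← h (k + 1) hk] at h2
      exact h1.south_west_unique h2
    refine fun k hk => ⟨?_, fun k hk e => (loc k hk e).2⟩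
    induction hk using Nat.decreasingInduction with
    | self => exact htop i hj hi.le
    | of_succ k hk ih => exact (loc k hk ih).1
  have cols : ∀ i, j ≤ i → i ≤ w.length → ∀ k ≤ N, grow (w.take i) k = grow (w'.take i) k := by
    intro i hj hi
    induction hi using Nat.decreasingInduction with
    | self =>
      intro k hk
      rw [List.take_length, hlen, List.take_length, hright k hk]
    | of_succ i hi ih => exact fun k hk => (key i hi hj (ih (by omega)) k hk).1
  refine ⟨cols, fun i hi hj k hk => ?_⟩
  exact (key i hi hj (cols (i + 1) (by omega) hi) N le_rfl).2 k hk (cols i hj hi.le (k + 1) hk)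

lemma IsGrowth.mono {g : ℕ → ℕ → ℕ} (hg : IsGrowth g) : Monotone g := by
  refine monotone_nat_of_le_succ fun k t => ?_
  rcases hg.step k with h | ⟨s, h⟩ <;> rw [h]
  simp only [addCell]
  split_ifs <;> omega

lemma IsGrowth.exists_extend {g : ℕ → ℕ → ℕ} (hg : IsGrowth g) (N : ℕ) {h : ℕ → ℕ}
    (hh : Antitone h) (hs : h = g N ∨ ∃ s, h = addCell (g N) s) :
    ∃ g', IsGrowth g' ∧ (∀ k ≤ N, g' k = g k) ∧ ∀ k, N + 1 ≤ k → g' k = h := by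
  refine ⟨fun k => if k ≤ N then g k else h, ⟨by simp [hg.zero], fun k => ?_, fun k => ?_⟩,
    fun k hk => if_pos hk, fun k hk => if_neg (by omega)⟩
  · split_ifs
    exacts [hg.antitone k, hh]
  · rcases lt_trichotomy k N with hk | rfl | hk
    · simpa [hk.le, Nat.succ_le_of_lt hk] using hg.step k
    · simpa using hs
    · simp [hk.not_ge, (Nat.lt_succ_of_lt hk).not_ge]

lemma exists_growInsert_eq (N : ℕ) {f : ℕ → ℕ → ℕ} (hf : IsGrowth f) {h : ℕ → ℕ} {r : ℕ}
    (hh : Antitone h) (hN : f N = addCell h r) :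
    ∃ g x, IsGrowth g ∧ x < N ∧ g (x + 1) = g x ∧ (∀ k, N ≤ k → g k = h) ∧ growRow g x N = r ∧
      ∀ k ≤ N, growInsert g x k = f k := by
  induction N generalizing h r with
  | zero =>
    have := congrFun hN r
    simp [hf.zero, addCell] at this
  | succ N ih =>
    have extend : ∀ {h' : ℕ → ℕ} {r' s : ℕ}, Antitone h' → f N = addCell h' r' →
        h = addCell h' s → (s = r' → r = r' + 1) → (s ≠ r' → r = r') →
        ∃ g x, IsGrowth g ∧ x < N + 1 ∧ g (x + 1) = g x ∧ (∀ k, N + 1 ≤ k → g k = h) ∧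
          growRow g x (N + 1) = r ∧ ∀ k ≤ N + 1, growInsert g x k = f k := by
      intro h' r' s hh' hfN hs h1 h2
      obtain ⟨g, x, hg, hx, hgx, hgN, hr, hins⟩ := ih hh' hfN
      obtain ⟨g', hg', hcongr, hsucc⟩ :=
        hg.exists_extend N hh (.inr ⟨s, by rw [hs, hgN N le_rfl]⟩)
      have hstep : g' (N + 1) = addCell (g' N) s := by
        rw [hsucc _ le_rfl, hcongr N le_rfl, hgN N le_rfl, hs]
      have hrow : growRow g' x N = r' := (growRow_congr x hcongr).trans hr
      have hrow' : growRow g' x (N + 1) = r := by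
        by_cases hsr : s = r'
        · rw [growRow_succ_of_eq_row hx (by rw [hrow, hstep, hsr]), hrow, h1 hsr]
        · rw [growRow_succ_of_ne_row hstep (by rw [hrow]; exact hsr), hrow, h2 hsr]
      refine ⟨g', x, hg', by omega, ?_, hsucc, hrow', fun k hk => ?_⟩
      · rw [hcongr _ hx, hcongr _ hx.le, hgx]
      · rcases hk.lt_or_eq with hk | rfl
        · rw [growInsert_congr x fun j hj => hcongr j (by omega), hins k (by omega)]
        · rw [growInsert, if_neg (by omega), hrow', hsucc _ le_rfl, hN]
    rcases hf.step N with hs | ⟨s, hs⟩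
    · obtain ⟨g, x, hg, hx, hgx, hgN, hr, hins⟩ := ih hh (hs ▸ hN)
      have hrow : growRow g x (N + 1) = r := by
        rw [growRow_succ_of_eq x (by rw [hgN N le_rfl, hgN (N + 1) (by omega)]), hr]
      refine ⟨g, x, hg, by omega, hgx, fun k hk => hgN k (by omega), hrow, fun k hk => ?_⟩
      rcases hk.lt_or_eq with hk | rfl
      · exact hins k (by omega)
      · rw [growInsert, if_neg (by omega), hrow, hgN _ (by omega), hN]
    · rw [hs] at hN
      by_cases hsr : s = r
      · subst hsr
        rw [addCell_left_inj] at hN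
        rcases s with _ | r'
        · obtain ⟨g', hg', hcongr, hsucc⟩ := hf.exists_extend N hh (.inl hN.symm)
          refine ⟨g', N, hg', by omega, ?_, hsucc, growRow_self_succ _ _, fun k hk => ?_⟩
          · rw [hsucc _ le_rfl, hcongr N le_rfl, hN]
          · rcases hk.lt_or_eq with hk | rfl
            · rw [growInsert, if_pos (by omega), hcongr k (by omega)]
            · rw [growInsert, if_neg (by omega), growRow_self_succ, hsucc _ le_rfl, hs, hN]
        · have hlt : h (r' + 1) < h r' := by
            have := hf.antitone (N + 1) (Nat.le_succ r')
            simp only [hs, hN, addCell, Nat.succ_eq_add_one] at this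
            grind
          have hh' : h = addCell (fun t => if t = r' then h t - 1 else h t) r' := by
            funext t
            simp only [addCell]
            grind
          refine extend (h' := fun t => if t = r' then h t - 1 else h t) (r' := r') (s := r') ?_
            (by rw [hN]; exact hh') hh' (fun _ => rfl) (fun h => absurd rfl h)
          refine antitone_nat_of_succ_le fun t => ?_
          have := hh (Nat.le_succ t)
          simp only [Nat.succ_eq_add_one] at this
          grind
      · have hpt : ∀ t, addCell (f N) s t = addCell h r t := congrFun hN
        simp only [addCell] at hpt
        refine extend (h' := fun t => min (h t) (f N t)) (r' := r) (s := s) ?_ ?_ ?_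
          (fun h => absurd h hsr) (fun _ => rfl)
        · exact fun t u htu => min_le_min (hh htu) (hf.antitone N htu)
        · funext t
          have := hpt t
          simp only [addCell]
          grind
        · funext t
          have := hpt t
          simp only [addCell]
          grind

lemma exists_grow_eq (n N : ℕ) {f : ℕ → ℕ → ℕ} (hf : IsGrowth f) {c : ℕ → ℕ → ℕ} (h0 : c 0 = 0)
    (hanti : ∀ i, Antitone (c i)) (hstep : ∀ i < n, ∃ r, c (i + 1) = addCell (c i) r)
    (hn : c n = f N) :
    ∃ w : List ℕ, w.Nodup ∧ w.length = n ∧ (∀ u ∈ w, u < N) ∧ (∀ k ≤ N, grow w k = f k) ∧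
      ∀ i ≤ n, grow (w.take i) N = c i := by
  induction n generalizing f with
  | zero =>
    refine ⟨[], by simp, rfl, by simp, fun k hk => ?_, fun i hi => ?_⟩
    · have := hf.mono hk
      rw [← hn, h0] at this
      exact (le_antisymm this fun _ => Nat.zero_le _).symm
    · obtain rfl : i = 0 := by omega
      exact h0.symm
  | succ n ih =>
    obtain ⟨r, hr⟩ := hstep n (by omega)
    obtain ⟨g, x, hg, hx, hgx, hgN, -, hins⟩ :=
      exists_growInsert_eq N hf (hanti n) (hn.symm.trans hr)
    obtain ⟨w, hw, hlen, hlt, hgrow, htop⟩ :=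
      ih hg (fun i hi => hstep i (by omega)) (hgN N le_rfl).symm
    have hxw : x ∉ w := by
      rw [← grow_succ_eq_iff hw, hgrow _ hx, hgrow _ hx.le, hgx]
    have hgrow' : ∀ k ≤ N, grow (w ++ [x]) k = f k := fun k hk => by
      rw [grow_append_singleton, ← hins k hk]
      exact growInsert_congr x fun j hj => hgrow j (hj.trans hk)
    refine ⟨w ++ [x], ?_, by simp [hlen], ?_, hgrow', fun i hi => ?_⟩
    · rw [List.nodup_append]
      refine ⟨hw, by simp, ?_⟩
      simp only [List.mem_singleton]
      rintro u hu _ rfl rfl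
      exact hxw hu
    · simp only [List.mem_append, List.mem_singleton]
      rintro u (hu | rfl)
      exacts [hlt u hu, hx]
    · rcases hi.lt_or_eq with hi | rfl
      · rw [List.take_append_of_le_length (by omega), htop i (by omega)]
      · rw [List.take_of_length_le (by simp [hlen]), hgrow' N le_rfl, hn]

lemma exists_wordOf_eq {n : ℕ} {w : List ℕ} (hw : w.Nodup) (hlen : w.length = n)
    (hlt : ∀ u ∈ w, u < n) : ∃ σ : Equiv.Perm (Fin n), wordOf σ = w := by
  let v : Fin n → Fin n := fun i => ⟨w[(i : ℕ)], hlt _ (List.getElem_mem _)⟩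
  have hv : Function.Injective v := fun i j hij => by
    have := congrArg Fin.val hij
    exact Fin.ext ((List.Nodup.getElem_inj_iff hw).1 this)
  refine ⟨Equiv.ofBijective v (Finite.injective_iff_bijective.1 hv), ?_⟩
  refine List.ext_getElem (by rw [length_wordOf, hlen]) fun i h1 h2 => ?_
  rw [getElem_wordOf]
  rfl

lemma rowLen_eq_addCell_iff {d e : YoungDiagram} {r : ℕ} :
    e.rowLen = addCell d.rowLen r ↔ e.cells = insert (r, d.rowLen r) d.cells := by
  constructor
  · intro h
    ext ⟨i, j⟩
    rw [Finset.mem_insert, YoungDiagram.mem_cells, YoungDiagram.mem_cells,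
      YoungDiagram.mem_iff_lt_rowLen, YoungDiagram.mem_iff_lt_rowLen, h, Prod.mk.injEq]
    simp only [addCell]
    grind
  · intro h
    funext i
    refine eq_of_forall_lt_iff fun j => ?_
    rw [← YoungDiagram.mem_iff_lt_rowLen, ← YoungDiagram.mem_cells, h, Finset.mem_insert,
      YoungDiagram.mem_cells, YoungDiagram.mem_iff_lt_rowLen, Prod.mk.injEq]
    simp only [addCell]
    grind

lemma cells_sdiff_of_rowLen_eq {d e : YoungDiagram} {r : ℕ}
    (h : e.rowLen = addCell d.rowLen r) : e.cells \ d.cells = {(r, d.rowLen r)} := by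
  rw [rowLen_eq_addCell_iff.1 h, Finset.insert_sdiff_of_notMem, Finset.sdiff_self]
  · rfl
  · simp [YoungDiagram.mem_iff_lt_rowLen]

lemma le_and_card_eq_iff {d e : YoungDiagram} :
    d ≤ e ∧ e.card = d.card + 1 ↔ ∃ r, e.rowLen = addCell d.rowLen r := by
  simp only [rowLen_eq_addCell_iff]
  constructor
  · rintro ⟨hle, hcard⟩
    have hsub : d.cells ⊆ e.cells := YoungDiagram.cells_subset_iff.2 hle
    have h1 : (e.cells \ d.cells).card = 1 := by
      rw [Finset.card_sdiff_of_subset hsub]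
      change e.card - d.card = 1
      omega
    obtain ⟨⟨r, s⟩, hrs⟩ := Finset.card_eq_one.1 h1
    have he : e.cells = insert (r, s) d.cells := by
      rw [← Finset.union_sdiff_of_subset hsub, hrs, Finset.union_comm]
      rfl
    refine ⟨r, ?_⟩
    have hmem : (r, s) ∈ e.cells \ d.cells := by simp [hrs]
    rw [Finset.mem_sdiff, YoungDiagram.mem_cells, YoungDiagram.mem_cells,
      YoungDiagram.mem_iff_lt_rowLen (μ := d)] at hmem
    have hlast : (r, d.rowLen r) ∈ e.cells :=
      e.isLowerSet (show (r, d.rowLen r) ≤ (r, s) from ⟨le_rfl, not_lt.1 hmem.2⟩) hmem.1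
    rw [he, Finset.mem_insert, YoungDiagram.mem_cells, YoungDiagram.mem_iff_lt_rowLen,
      Prod.mk.injEq] at hlast
    have : d.rowLen r = s := by
      rcases hlast with h | h
      exacts [h.2, absurd h (lt_irrefl _)]
    rw [this, he]
  · rintro ⟨r, h⟩
    refine ⟨YoungDiagram.cells_subset_iff.1 (h ▸ Finset.subset_insert _ _), ?_⟩
    rw [YoungDiagram.card, h, Finset.card_insert_of_notMem]
    simp [YoungDiagram.mem_iff_lt_rowLen]

lemma isSYTChain_iff {n : ℕ} {c : Fin (n + 1) → YoungDiagram} :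
    IsSYTChain c ↔ ∀ i (h : i < n), ∃ r,
      (c ⟨i + 1, by omega⟩).rowLen = addCell (c ⟨i, by omega⟩).rowLen r := by
  simp only [IsSYTChain, le_and_card_eq_iff]

lemma rowLen_bot : (⊥ : YoungDiagram).rowLen = 0 := by
  funext i
  refine eq_of_forall_lt_iff fun j => ?_
  rw [← YoungDiagram.mem_iff_lt_rowLen]
  simp

lemma rowOfStep_eq {n : ℕ} {c : Fin (n + 1) → YoungDiagram} {i r : ℕ} (hi : i < n)
    (h : (c ⟨i + 1, by omega⟩).rowLen = addCell (c ⟨i, by omega⟩).rowLen r) :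
    rowOfStep c i = r := by
  rw [rowOfStep, dif_pos hi, cells_sdiff_of_rowLen_eq h, Finset.sup_singleton]

section RobinsonSchensted

variable {n : ℕ}

lemma rowLen_Qchain_succ (σ : Equiv.Perm (Fin n)) {i : ℕ} (hi : i < n) :
    (Qchain σ ⟨i + 1, by omega⟩).rowLen = addCell (Qchain σ ⟨i, by omega⟩).rowLen
      (growRow (grow ((wordOf σ).take i)) (σ ⟨i, hi⟩) n) := by
  have hi' : i < (wordOf σ).length := by rwa [length_wordOf]
  rw [rowLen_Qchain, rowLen_Qchain]
  change grow (List.take (i + 1) _) n = _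
  rw [← List.take_append_getElem hi', grow_append_singleton, growInsert, getElem_wordOf,
    if_neg (by simp)]

lemma isSYTChain_Qchain (σ : Equiv.Perm (Fin n)) : IsSYTChain (Qchain σ) :=
  isSYTChain_iff.2 fun _ hi => ⟨_, rowLen_Qchain_succ σ hi⟩

lemma Qchain_zero (σ : Equiv.Perm (Fin n)) : Qchain σ 0 = ⊥ := by
  apply rowLen_injective
  rw [rowLen_Qchain, rowLen_bot]
  rfl

lemma isSYTChain_Pchain (σ : Equiv.Perm (Fin n)) : IsSYTChain (Pchain σ) := by
  rw [← inv_inv σ, Pchain_inv]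
  exact isSYTChain_Qchain _

lemma Pchain_zero (σ : Equiv.Perm (Fin n)) : Pchain σ 0 = ⊥ := by
  rw [← inv_inv σ, Pchain_inv, Qchain_zero]

lemma Pchain_last (σ : Equiv.Perm (Fin n)) : Pchain σ (Fin.last n) = Qchain σ (Fin.last n) := by
  apply rowLen_injective
  rw [rowLen_Pchain, rowLen_Qchain, Fin.val_last, List.take_of_length_le (length_wordOf σ).le]

lemma exists_Pchain_Qchain_eq {c d : Fin (n + 1) → YoungDiagram} (hc0 : c 0 = ⊥)
    (hc : IsSYTChain c) (hd0 : d 0 = ⊥) (hd : IsSYTChain d) (h : c (Fin.last n) = d (Fin.last n)) :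
    ∃ σ : Equiv.Perm (Fin n), Pchain σ = c ∧ Qchain σ = d := by
  rw [isSYTChain_iff] at hc hd
  have hf : IsGrowth fun k => (c ⟨min k n, by omega⟩).rowLen := by
    refine ⟨?_, fun k _ _ h => YoungDiagram.rowLen_anti _ _ _ h, fun k => ?_⟩
    · simp only [Nat.zero_min]
      exact (congrArg YoungDiagram.rowLen hc0).trans rowLen_bot
    · rcases lt_or_ge k n with hk | hk
      · right
        simp only [min_eq_left hk.le, min_eq_left (Nat.succ_le_of_lt hk)]
        exact hc k hk
      · left
        simp only [min_eq_right hk, min_eq_right (Nat.le_succ_of_le hk)]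
  obtain ⟨w, hw, hlen, hlt, hgrow, htop⟩ := exists_grow_eq n n hf
    (c := fun k => (d ⟨min k n, by omega⟩).rowLen)
    (by simp only [Nat.zero_min]; exact (congrArg YoungDiagram.rowLen hd0).trans rowLen_bot)
    (fun k _ _ h => YoungDiagram.rowLen_anti _ _ _ h)
    (fun i hi => by
      simp only [min_eq_left hi.le, min_eq_left (Nat.succ_le_of_lt hi)]
      exact hd i hi)
    (by simp only [min_self]; exact congrArg YoungDiagram.rowLen h.symm)
  obtain ⟨σ, rfl⟩ := exists_wordOf_eq hw hlen hlt
  refine ⟨σ, funext fun i => rowLen_injective ?_, funext fun i => rowLen_injective ?_⟩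
  · have hi := i.is_le
    rw [rowLen_Pchain, hgrow i hi]
    simp only [min_eq_left hi]
  · have hi := i.is_le
    rw [rowLen_Qchain, htop i hi]
    simp only [min_eq_left hi]

lemma eq_of_Pchain_eq_of_Qchain_eq {σ τ : Equiv.Perm (Fin n)} {j : ℕ} (hP : Pchain σ = Pchain τ)
    (hQ : ∀ i : Fin (n + 1), j ≤ i → Qchain σ i = Qchain τ i) :
    (∀ i : Fin (n + 1), j ≤ i → ∀ k ≤ n, grow ((wordOf σ).take i) k = grow ((wordOf τ).take i) k) ∧
      ∀ i : Fin n, j ≤ i → σ i = τ i := by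
  obtain ⟨h1, h2⟩ := grow_take_unique (nodup_wordOf σ) (nodup_wordOf τ)
    (by rw [length_wordOf, length_wordOf]) (N := n) (j := j)
    (fun k hk => by
      simpa only [rowLen_Pchain] using congrArg YoungDiagram.rowLen (congrFun hP ⟨k, by omega⟩))
    (fun i hj hi => by
      rw [length_wordOf] at hi
      simpa only [rowLen_Qchain] using congrArg YoungDiagram.rowLen (hQ ⟨i, by omega⟩ hj))
  refine ⟨fun i hj => h1 i hj (by rw [length_wordOf]; exact i.is_le), fun i hj => ?_⟩
  have := (h2 i (by rw [length_wordOf]; exact i.isLt) hj (σ i) (σ i).isLt).1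
    (getElem_wordOf σ _ _)
  rw [getElem_wordOf] at this
  exact Fin.ext this.symm

lemma Pchain_Qchain_injective {σ τ : Equiv.Perm (Fin n)} (hP : Pchain σ = Pchain τ)
    (hQ : Qchain σ = Qchain τ) : σ = τ :=
  Equiv.ext fun i =>
    (eq_of_Pchain_eq_of_Qchain_eq hP fun i _ => congrFun hQ i).2 i (Nat.zero_le _)

lemma rowOfStep_Qchain_lt_iff (σ : Equiv.Perm (Fin n)) {i : ℕ} (hi : i + 1 < n) :
    rowOfStep (Qchain σ) i < rowOfStep (Qchain σ) (i + 1) ↔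
      σ ⟨i + 1, hi⟩ < σ ⟨i, by omega⟩ := by
  have hi' : i < (wordOf σ).length := by rw [length_wordOf]; omega
  rw [rowOfStep_eq (by omega) (rowLen_Qchain_succ σ (by omega)),
    rowOfStep_eq hi (rowLen_Qchain_succ σ hi), ← List.take_append_getElem hi',
    grow_append_singleton, getElem_wordOf]
  have hw : ((wordOf σ).take i).Nodup := (nodup_wordOf σ).take
  have hx : ((σ ⟨i, by omega⟩ : Fin n) : ℕ) ∉ (wordOf σ).take i := by
    have := (nodup_wordOf σ).take (i := i + 1)
    rw [← List.take_append_getElem hi'] at this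
    have := (List.nodup_append.1 this).2.2
    intro h
    exact this _ h _ (by simp) (getElem_wordOf σ i hi').symm
  have hne : σ ⟨i + 1, hi⟩ ≠ σ ⟨i, by omega⟩ := by simp
  rcases lt_or_gt_of_ne hne with h | h
  · exact iff_of_true (lt_growRow_growInsert (isGrowth_grow hw) ((grow_succ_eq_iff hw).2 hx) h
      (Fin.isLt _)) h
  · exact iff_of_false (growRow_growInsert_le (isGrowth_grow hw) h (Fin.isLt _)).not_gt h.not_gt

end RobinsonSchensted

section Relabel

variable {φ : ℕ → ℕ} (hφ : StrictMono φ)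
include hφ

lemma insertRow_map (R : List ℕ) (x : ℕ) :
    insertRow (R.map φ) (φ x) = ((insertRow R x).1.map φ, (insertRow R x).2.map φ) := by
  induction R with
  | nil => rfl
  | cons u R ih =>
    simp only [List.map_cons, insertRow, hφ.lt_iff_lt, ih]
    split_ifs <;> rfl

lemma insertTab_map (T : List (List ℕ)) (x : ℕ) :
    insertTab (T.map (List.map φ)) (φ x) = (insertTab T x).map (List.map φ) := by
  induction T generalizing x with
  | nil => rfl
  | cons R T ih =>
    simp only [List.map_cons, insertTab, insertRow_map hφ]
    rcases insertRow R x with ⟨R', _ | y⟩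
    · rfl
    · simp [ih]

lemma Ptab_map (w : List ℕ) : Ptab (w.map φ) = (Ptab w).map (List.map φ) := by
  induction w using List.reverseRecOn with
  | nil => rfl
  | append_singleton w x ih =>
    rw [List.map_append, List.map_singleton, Ptab_append_singleton, Ptab_append_singleton, ih,
      insertTab_map hφ]

lemma RSshape_map (w : List ℕ) : RSshape (w.map φ) = RSshape w := by
  rw [RSshape, RSshape, Ptab_map hφ, List.map_map]
  congr 2
  funext R
  simp

end Relabel

/-- The increasing enumeration of `S`, continued to a strictly increasing function on `ℕ`. -/
noncomputable def enumExtend {n : ℕ} (S : Finset (Fin n)) (t : ℕ) : ℕ :=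
  if h : t < S.card then S.orderEmbOfFin rfl ⟨t, h⟩ else n + t

lemma enumExtend_strictMono {n : ℕ} (S : Finset (Fin n)) : StrictMono (enumExtend S) := by
  intro s t hst
  rw [enumExtend, enumExtend]
  split_ifs with h1 h2
  · exact (S.orderEmbOfFin rfl).strictMono (show (⟨s, h1⟩ : Fin _) < ⟨t, h2⟩ from hst)
  · omega
  · omega
  · omega

lemma enumExtend_of_lt {n k : ℕ} {S : Finset (Fin n)} (hS : S.card = k) (i : Fin k) :
    enumExtend S i = S.orderEmbOfFin hS i := by
  subst hS
  rw [enumExtend, dif_pos i.isLt]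

lemma enumExtend_standardize {n k : ℕ} (v : Fin k → Fin n) (hv : Function.Injective v)
    (i : Fin k) : enumExtend (Finset.image v Finset.univ) (standardize v hv i) = v i := by
  have hS : (Finset.image v Finset.univ).card = k := by
    rw [Finset.card_image_of_injective _ hv, Finset.card_univ, Fintype.card_fin]
  rw [enumExtend_of_lt hS, ← Finset.coe_orderIsoOfFin_apply]
  simp [standardize]

lemma standardize_lt_iff {n k : ℕ} (v : Fin k → Fin n) (hv : Function.Injective v)
    (i i' : Fin k) : standardize v hv i < standardize v hv i' ↔ v i < v i' := by
  rw [Fin.lt_def, Fin.lt_def, ← (enumExtend_strictMono (Finset.image v Finset.univ)).lt_iff_lt,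
    enumExtend_standardize, enumExtend_standardize]

/-- The chain obtained by continuing `d` with the steps of `c`. -/
def joinChain (n j : ℕ) (d : Fin (j + 1) → YoungDiagram) (c : Fin (n - j + 1) → YoungDiagram) :
    Fin (n + 1) → YoungDiagram :=
  fun i => if h : (i : ℕ) ≤ j then d ⟨i, by omega⟩ else c ⟨i - j, by omega⟩

section Restrict

variable {n j : ℕ} (hj : j ≤ n)

lemma map_wordOf_pInit (σ : Equiv.Perm (Fin n)) :
    (wordOf (pInit σ j hj)).map
      (enumExtend (Finset.image (fun i => σ (Fin.castLE hj i)) Finset.univ)) =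
      (wordOf σ).take j := by
  refine List.ext_getElem (by simp [length_wordOf, hj]) fun i h1 h2 => ?_
  rw [List.getElem_map, getElem_wordOf, List.getElem_take, getElem_wordOf]
  exact enumExtend_standardize _ _ _

lemma Qchain_pInit (σ : Equiv.Perm (Fin n)) (i : Fin (j + 1)) :
    Qchain (pInit σ j hj) i = Qchain σ ⟨i, by omega⟩ := by
  rw [Qchain, Qchain, ← RSshape_map (enumExtend_strictMono
    (Finset.image (fun i => σ (Fin.castLE hj i)) Finset.univ)), List.map_take, map_wordOf_pInit,
    List.take_take, min_eq_left i.is_le]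

lemma Pchain_pInit (σ : Equiv.Perm (Fin n)) (i : Fin (j + 1)) :
    (Pchain (pInit σ j hj) i).rowLen = grow ((wordOf σ).take j)
      (min n (enumExtend (Finset.image (fun i => σ (Fin.castLE hj i)) Finset.univ) i)) := by
  have hmap := map_wordOf_pInit hj σ
  have hmono := enumExtend_strictMono (Finset.image (fun i => σ (Fin.castLE hj i)) Finset.univ)
  generalize enumExtend (Finset.image (fun i => σ (Fin.castLE hj i)) Finset.univ) = φ at *
  have hlt : ∀ u ∈ (wordOf σ).take j, u < n :=
    fun u hu => lt_of_mem_wordOf σ (List.mem_of_mem_take hu)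
  have hfilter : ((wordOf (pInit σ j hj)).filter fun x => x < (i : ℕ)).map φ =
      ((wordOf σ).take j).filter fun x => x < min n (φ i) := by
    rw [← hmap, List.filter_map]
    congr 1
    refine List.filter_congr fun x hx => ?_
    have : φ x < n := hlt _ (hmap ▸ List.mem_map_of_mem hx)
    simp [hmono.lt_iff_lt, this]
  rw [Pchain, ← RSshape_map hmono, hfilter,
    rowLen_RSshape ((nodup_wordOf σ).take.filter _) (N := min n (φ i)) (by simp),
    grow_filter _ _ le_rfl]

include hj in
lemma tailChain_apply (c : Fin (n + 1) → YoungDiagram) (i : Fin (n - j + 1)) :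
    tailChain c j i = c ⟨j + i, by omega⟩ := by
  rw [tailChain]
  congr
  omega

lemma Pchain_pInit_congr {σ τ : Equiv.Perm (Fin n)} (hP : Pchain σ = Pchain τ)
    (hQ : tailChain (Qchain σ) j = tailChain (Qchain τ) j) :
    Pchain (pInit σ j hj) = Pchain (pInit τ j hj) := by
  obtain ⟨h1, h2⟩ := eq_of_Pchain_eq_of_Qchain_eq (j := j) hP fun i hi => by
    have := congrFun hQ ⟨i - j, by omega⟩
    simpa only [tailChain_apply hj, Nat.add_sub_cancel' hi] using this
  have hsub : ∀ {σ τ : Equiv.Perm (Fin n)}, (∀ i : Fin n, j ≤ i → σ i = τ i) →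
      Finset.image (fun i => σ (Fin.castLE hj i)) Finset.univ ⊆
        Finset.image (fun i => τ (Fin.castLE hj i)) Finset.univ := by
    intro σ τ h x hx
    simp only [Finset.mem_image, Finset.mem_univ, true_and] at hx ⊢
    obtain ⟨i, rfl⟩ := hx
    have hlt : (τ⁻¹ (σ (Fin.castLE hj i)) : ℕ) < j := by
      by_contra hge
      have := h _ (not_lt.1 hge)
      rw [show τ (τ⁻¹ (σ (Fin.castLE hj i))) = σ (Fin.castLE hj i) by simp] at this
      have := congrArg Fin.val (σ.injective this)
      have hi := i.isLt
      simp only [Fin.val_castLE] at this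
      omega
    exact ⟨⟨_, hlt⟩, by simp⟩
  have himage := (hsub h2).antisymm (hsub fun i hi => (h2 i hi).symm)
  funext i
  apply rowLen_injective
  rw [Pchain_pInit, Pchain_pInit, himage]
  exact h1 ⟨j, by omega⟩ le_rfl _ (min_le_left _ _)

include hj in
lemma maj_pTail (σ : Equiv.Perm (Fin n)) :
    maj (pTail σ j) = chainMaj (tailChain (Qchain σ) j) := by
  have hrow : ∀ i < n - j, rowOfStep (tailChain (Qchain σ) j) i = rowOfStep (Qchain σ) (j + i) := by
    intro i hi
    rw [rowOfStep, rowOfStep, dif_pos hi, dif_pos (by omega), tailChain_apply hj,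
      tailChain_apply hj]
    rfl
  refine Finset.sum_congr rfl fun i _ => ?_
  by_cases h : i + 1 < n - j
  · rw [dif_pos h]
    refine if_congr ?_ rfl rfl
    rw [hrow i (by omega), hrow (i + 1) h, ← add_assoc, rowOfStep_Qchain_lt_iff σ (by omega)]
    exact (standardize_lt_iff _ _ _ _).trans (and_iff_right h).symm
  · rw [dif_neg h, if_neg fun h' => h h'.1]

variable {d : Fin (j + 1) → YoungDiagram} {c : Fin (n - j + 1) → YoungDiagram}

lemma joinChain_of_le {i : ℕ} (hi : i ≤ j) :
    joinChain n j d c ⟨i, by omega⟩ = d ⟨i, by omega⟩ := dif_pos hi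

lemma joinChain_add (h : d (Fin.last j) = c 0) {i : ℕ} (hi : i < n - j + 1) :
    joinChain n j d c ⟨j + i, by omega⟩ = c ⟨i, hi⟩ := by
  rw [joinChain]
  rcases Nat.eq_zero_or_pos i with rfl | hpos
  · rw [dif_pos (by simp)]
    exact h
  · rw [dif_neg (by simp; omega)]
    congr
    simp

include hj in
lemma tailChain_joinChain (h : d (Fin.last j) = c 0) :
    tailChain (joinChain n j d c) j = c := by
  funext i
  rw [tailChain_apply hj, joinChain_add hj h i.isLt]

include hj in
lemma isSYTChain_joinChain (h : d (Fin.last j) = c 0) (hd : IsSYTChain d) (hc : IsSYTChain c) :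
    IsSYTChain (joinChain n j d c) := by
  intro i hi
  rcases lt_or_ge i j with hij | hij
  · rw [joinChain_of_le hj hij.le, joinChain_of_le hj (Nat.succ_le_of_lt hij)]
    exact hd i hij
  · obtain ⟨k, rfl⟩ := Nat.exists_eq_add_of_le hij
    simp only [add_assoc]
    rw [joinChain_add hj h (by omega), joinChain_add hj h (by omega)]
    exact hc k (by omega)

include hj in
lemma isSYTChain_tailChain {c : Fin (n + 1) → YoungDiagram} (hc : IsSYTChain c) :
    IsSYTChain (tailChain c j) := by
  intro i hi
  rw [tailChain_apply hj, tailChain_apply hj]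
  exact hc (j + i) (by omega)

include hj in
lemma tailChain_zero (c : Fin (n + 1) → YoungDiagram) : tailChain c j 0 = c ⟨j, by omega⟩ :=
  tailChain_apply hj c 0

include hj in
lemma tailChain_last (c : Fin (n + 1) → YoungDiagram) :
    tailChain c j (Fin.last _) = c (Fin.last n) := by
  rw [tailChain_apply hj]
  congr
  simp [hj]

lemma exists_pInit_eq (σ : Equiv.Perm (Fin n)) (ρ : Equiv.Perm (Fin j))
    (h : Pchain ρ = Pchain (pInit σ j hj)) :
    ∃ σ', Pchain σ' = Pchain σ ∧ tailChain (Qchain σ') j = tailChain (Qchain σ) j ∧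
      pInit σ' j hj = ρ := by
  have hjoin : Qchain ρ (Fin.last j) = tailChain (Qchain σ) j 0 := by
    rw [← Pchain_last, h, Pchain_last, Qchain_pInit, tailChain_zero hj]
    rfl
  have htail := tailChain_joinChain hj hjoin
  obtain ⟨σ', hP, hQ⟩ := exists_Pchain_Qchain_eq (c := Pchain σ)
    (d := joinChain n j (Qchain ρ) (tailChain (Qchain σ) j)) (Pchain_zero σ) (isSYTChain_Pchain σ)
    (by
      rw [← Qchain_zero ρ]
      exact joinChain_of_le hj (Nat.zero_le j))
    (isSYTChain_joinChain hj hjoin (isSYTChain_Qchain ρ)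
      (isSYTChain_tailChain hj (isSYTChain_Qchain σ)))
    (by rw [← tailChain_last hj (joinChain _ _ _ _), htail, tailChain_last hj, Pchain_last])
  have htail' : tailChain (Qchain σ') j = tailChain (Qchain σ) j := by rw [hQ, htail]
  refine ⟨σ', hP, htail', Pchain_Qchain_injective ?_ (funext fun i => ?_)⟩
  · rw [h]
    exact Pchain_pInit_congr hj hP htail'
  · rw [Qchain_pInit, hQ]
    exact joinChain_of_le hj i.is_le

end Restrict

lemma exists_chain (n : ℕ) (μ : YoungDiagram) (hμ : μ.card = n) :
    ∃ c : ℕ → YoungDiagram, c 0 = ⊥ ∧ c n = μ ∧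
      ∀ i < n, c i ≤ c (i + 1) ∧ (c (i + 1)).card = (c i).card + 1 := by
  induction n generalizing μ with
  | zero =>
    refine ⟨fun _ => ⊥, rfl, ?_, by simp⟩
    ext x
    simp [Finset.card_eq_zero.1 hμ]
  | succ n ih =>
    obtain ⟨x, hx⟩ := μ.cells.exists_maximal (Finset.card_pos.1 (by change 0 < μ.card; omega))
    let μ' : YoungDiagram := ⟨μ.cells.erase x, by
      intro y z hzy hy
      rw [Finset.mem_coe, Finset.mem_erase] at hy ⊢
      refine ⟨?_, μ.isLowerSet hzy hy.2⟩
      rintro rfl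
      exact hy.1 (le_antisymm (hx.2 hy.2 hzy) hzy)⟩
    have hcard : μ'.card = n := by
      change (μ.cells.erase x).card = n
      rw [Finset.card_erase_of_mem hx.1]
      change μ.card - 1 = n
      omega
    obtain ⟨c, h0, hn, hc⟩ := ih μ' hcard
    refine ⟨fun i => if i ≤ n then c i else μ, by simp [h0], by simp, fun i hi => ?_⟩
    rcases (Nat.lt_succ_iff.1 hi).lt_or_eq with hi | rfl
    · simpa [hi.le, Nat.succ_le_of_lt hi] using hc i hi
    · simp only [le_refl, if_true, hn, hcard, hμ, Nat.not_succ_le_self, if_false, and_true]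
      exact YoungDiagram.cells_subset_iff.1 (Finset.erase_subset _ _)

lemma mem_subDiagrams {d l : YoungDiagram} : d ∈ subDiagrams l ↔ d ≤ l := by
  classical
  rw [subDiagrams, Finset.mem_image]
  constructor
  · rintro ⟨⟨s, hs⟩, -, rfl⟩
    exact YoungDiagram.cells_subset_iff.1 (Finset.mem_powerset.1 (Finset.mem_filter.1 hs).1)
  · intro h
    exact ⟨⟨d.cells, Finset.mem_filter.2
      ⟨Finset.mem_powerset.2 (YoungDiagram.cells_subset_iff.2 h), d.isLowerSet⟩⟩,
      Finset.mem_attach _ _, rfl⟩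

lemma mem_diagramsOfCard {d : YoungDiagram} {k : ℕ} : d ∈ diagramsOfCard k ↔ d.card = k := by
  rw [diagramsOfCard, Finset.mem_filter, mem_subDiagrams, and_iff_right_iff_imp]
  rintro rfl ⟨i, j⟩ hij
  have h1 : (Finset.range (i + 1) ×ˢ {0}) ⊆ d.cells := by
    rintro ⟨i', j'⟩ h
    rw [Finset.mem_product, Finset.mem_range, Finset.mem_singleton] at h
    exact d.isLowerSet (show (i', j') ≤ (i, j) from ⟨by simp; omega, by simp; omega⟩) hij
  have h2 : ({0} ×ˢ Finset.range (j + 1)) ⊆ d.cells := by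
    rintro ⟨i', j'⟩ h
    rw [Finset.mem_product, Finset.mem_range, Finset.mem_singleton] at h
    exact d.isLowerSet (show (i', j') ≤ (i, j) from ⟨by simp; omega, by simp; omega⟩) hij
  have h1 := Finset.card_le_card h1
  have h2 := Finset.card_le_card h2
  simp only [Finset.card_product, Finset.card_range, Finset.card_singleton, mul_one, one_mul] at h1 h2
  exact Finset.mem_product.2 ⟨Finset.mem_range.2 h1, Finset.mem_range.2 h2⟩

lemma IsSYTChain.monotone {n : ℕ} {c : Fin (n + 1) → YoungDiagram} (hc : IsSYTChain c) :
    Monotone c :=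
  Fin.monotone_iff_le_succ.2 fun i => (hc i i.isLt).1

lemma IsSYTChain.card {n : ℕ} {c : Fin (n + 1) → YoungDiagram} (hc : IsSYTChain c)
    (i : ℕ) (hi : i ≤ n) : (c ⟨i, by omega⟩).card = (c 0).card + i := by
  induction i with
  | zero => rfl
  | succ i ih => rw [(hc i (by omega)).2, ih (by omega), add_assoc]

lemma mem_skewSYT {μ l : YoungDiagram} {n : ℕ} {c : Fin (n + 1) → YoungDiagram} :
    c ∈ skewSYT μ l n ↔ c 0 = μ ∧ c (Fin.last n) = l ∧ IsSYTChain c := by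
  unfold skewSYT
  simp only [Finset.mem_filter, and_iff_right_iff_imp, Fintype.mem_piFinset]
  exact fun h i => mem_subDiagrams.2 (h.2.1 ▸ h.2.2.monotone (Fin.le_last i))

lemma mem_j2Set {a b j : ℕ} {σ : Equiv.Perm (Fin a)} {τ : Equiv.Perm (Fin b)} :
    j ∈ j2Set σ τ ↔ ∃ (ha : j ≤ a) (hb : j ≤ b), pInit σ j ha = vLow τ j hb := by
  rw [j2Set, Finset.mem_filter, and_iff_right_iff_imp]
  rintro ⟨ha, hb, -⟩
  rw [Finset.mem_range]
  omega

lemma fSkew_eq_zero_of_lt {μ l : YoungDiagram} (h : l.card < μ.card) (n : ℕ) (q : ℝ) :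
    fSkew μ l n q = 0 := by
  rw [fSkew, Finset.sum_eq_zero]
  intro c hc
  obtain ⟨rfl, rfl, hchain⟩ := mem_skewSYT.1 hc
  exact absurd
    (Finset.card_le_card (YoungDiagram.cells_subset_iff.2 (hchain.monotone (Fin.zero_le _)))) h.not_ge

lemma exists_tailChain_eq {n j : ℕ} (hj : j ≤ n) {μ l : YoungDiagram} (hμ : μ.card = j)
    {c : Fin (n + 1) → YoungDiagram} (hc : c ∈ skewSYT ⊥ l n)
    {u : Fin (n - j + 1) → YoungDiagram} (hu : u ∈ skewSYT μ l (n - j)) :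
    ∃ σ : Equiv.Perm (Fin n), Pchain σ = c ∧ tailChain (Qchain σ) j = u := by
  obtain ⟨hc0, hcl, hc⟩ := mem_skewSYT.1 hc
  obtain ⟨hu0, hul, hu⟩ := mem_skewSYT.1 hu
  obtain ⟨d, hd0, hdj, hd⟩ := exists_chain j μ hμ
  have hjoin : (fun i : Fin (j + 1) => d i) (Fin.last j) = u 0 := hdj.trans hu0.symm
  have htail := tailChain_joinChain hj (d := fun i => d i) hjoin
  obtain ⟨σ, hP, hQ⟩ := exists_Pchain_Qchain_eq (d := joinChain n j (fun i => d i) u) hc0 hc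
    ((joinChain_of_le hj (Nat.zero_le j)).trans hd0)
    (isSYTChain_joinChain hj hjoin (fun i hi => hd i hi) hu)
    (by rw [← tailChain_last hj (joinChain _ _ _ _), htail, hul, hcl])
  exact ⟨σ, hP, by rw [hQ, htail]⟩

lemma tailChain_Qchain_mem_skewSYT {n j : ℕ} (hj : j ≤ n) {l : YoungDiagram}
    {σ : Equiv.Perm (Fin n)} (h : Pchain σ ∈ skewSYT ⊥ l n) :
    tailChain (Qchain σ) j ∈ skewSYT (Qchain (pInit σ j hj) (Fin.last j)) l (n - j) := by
  refine mem_skewSYT.2 ⟨?_, ?_, isSYTChain_tailChain hj (isSYTChain_Qchain σ)⟩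
  · rw [tailChain_zero hj, Qchain_pInit]
    rfl
  · rw [tailChain_last hj, ← Pchain_last]
    exact (mem_skewSYT.1 h).2.1

lemma eq_of_tailChain_Qchain_eq {n j : ℕ} (hj : j ≤ n) {σ τ : Equiv.Perm (Fin n)}
    (hP : Pchain σ = Pchain τ) (hQ : tailChain (Qchain σ) j = tailChain (Qchain τ) j)
    (h : pInit σ j hj = pInit τ j hj) : σ = τ := by
  refine Pchain_Qchain_injective hP (funext fun i => ?_)
  rcases le_total (i : ℕ) j with hi | hi
  · have := Qchain_pInit hj σ ⟨i, by omega⟩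
    rw [h, Qchain_pInit] at this
    exact this.symm
  · have := congrFun hQ ⟨i - j, by omega⟩
    simpa only [tailChain_apply hj, Nat.add_sub_cancel' hi] using this

lemma imaj_vHigh {n j : ℕ} (hj : j ≤ n) (τ : Equiv.Perm (Fin n)) :
    imaj (vHigh τ j) = chainMaj (tailChain (Qchain τ⁻¹) j) := by
  rw [imaj, vHigh, inv_inv, maj_pTail hj]

lemma card_Qchain_last {n : ℕ} (σ : Equiv.Perm (Fin n)) : (Qchain σ (Fin.last n)).card = n := by
  have h := (isSYTChain_Qchain σ).card n le_rfl
  rw [Qchain_zero] at h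
  exact h.trans (Nat.zero_add n)

lemma pInit_eq_of_Pchain_eq {a b j : ℕ} (ha : j ≤ a) (hb : j ≤ b)
    {σ σ' : Equiv.Perm (Fin a)} {τ τ' : Equiv.Perm (Fin b)}
    (h : pInit σ j ha = (pInit τ j hb)⁻¹) (h' : pInit σ' j ha = (pInit τ' j hb)⁻¹)
    (hσ : Pchain (pInit σ j ha) = Pchain (pInit σ' j ha))
    (hτ : Pchain (pInit τ j hb) = Pchain (pInit τ' j hb)) :
    pInit σ j ha = pInit σ' j ha := by
  refine Pchain_Qchain_injective hσ ?_
  rw [← Pchain_inv, ← Pchain_inv, h, h', inv_inv, inv_inv, hτ]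

lemma exists_pInit_eq_inv {a b j : ℕ} (ha : j ≤ a) (hb : j ≤ b) {α β μ : YoungDiagram}
    (hμ : μ.card = j) {A : Fin (a + 1) → YoungDiagram} (hA : A ∈ skewSYT ⊥ α a)
    {B : Fin (b + 1) → YoungDiagram} (hB : B ∈ skewSYT ⊥ β b)
    {U : Fin (a - j + 1) → YoungDiagram} (hU : U ∈ skewSYT μ α (a - j))
    {V : Fin (b - j + 1) → YoungDiagram} (hV : V ∈ skewSYT μ β (b - j)) :
    ∃ (σ : Equiv.Perm (Fin a)) (τ : Equiv.Perm (Fin b)), Pchain σ = A ∧ Pchain τ = B ∧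
      tailChain (Qchain σ) j = U ∧ tailChain (Qchain τ) j = V ∧
      pInit σ j ha = (pInit τ j hb)⁻¹ := by
  obtain ⟨σ₀, rfl, rfl⟩ := exists_tailChain_eq ha hμ hA hU
  obtain ⟨τ₀, rfl, rfl⟩ := exists_tailChain_eq hb hμ hB hV
  have hσ := (mem_skewSYT.1 (tailChain_Qchain_mem_skewSYT ha hA)).1
  have hτ := (mem_skewSYT.1 (tailChain_Qchain_mem_skewSYT hb hB)).1
  rw [(mem_skewSYT.1 hU).1] at hσ
  rw [(mem_skewSYT.1 hV).1] at hτ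
  obtain ⟨ρ, hP, hQ⟩ := exists_Pchain_Qchain_eq (Pchain_zero (pInit σ₀ j ha))
    (isSYTChain_Pchain _) (Pchain_zero (pInit τ₀ j hb)) (isSYTChain_Pchain _)
    (by rw [Pchain_last, Pchain_last, ← hσ, ← hτ])
  obtain ⟨σ, hσP, hσQ, hσρ⟩ := exists_pInit_eq ha σ₀ ρ hP
  obtain ⟨τ, hτP, hτQ, hτρ⟩ := exists_pInit_eq hb τ₀ ρ⁻¹ (by rw [Pchain_inv, hQ])
  exact ⟨σ, τ, hσP, hτP, hσQ, hτQ, by rw [hσρ, hτρ, inv_inv]⟩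

open scoped Classical in
/-- For standard Young tableaux `A`, `B` of shapes `α ⊢ a`, `β ⊢ b`
and `j ≥ 0`,
`Σ_{(σ,τ) : P(σ)=A, Q(τ)=B, j ∈ J(σ,τ)} p^{imaj(τ_{>j})} q^{maj(σ^{>j})}
   = Σ_{μ ⊢ j} f^{β/μ}(p) f^{α/μ}(q)`. -/
theorem stmt10 {a b : ℕ} (α β : YoungDiagram) (hα : α.card = a) (hβ : β.card = b)
    (A : Fin (a + 1) → YoungDiagram) (hA : A ∈ skewSYT ⊥ α a)
    (B : Fin (b + 1) → YoungDiagram) (hB : B ∈ skewSYT ⊥ β b) (j : ℕ) (p q : ℝ) :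
    ∑ st ∈ (Finset.univ.filter
        fun st : Equiv.Perm (Fin a) × Equiv.Perm (Fin b) =>
          Pchain st.1 = A ∧ Qchain st.2 = B ∧ j ∈ j2Set st.1 st.2),
        p ^ imaj (vHigh st.2 j) * q ^ maj (pTail st.1 j) =
      ∑ μ ∈ diagramsOfCard j, fSkew μ β (b - j) p * fSkew μ α (a - j) q := by
  have hB' : ∀ τ : Equiv.Perm (Fin b), Qchain τ = B ↔ Pchain τ⁻¹ = B := by simp [Pchain_inv]
  by_cases hj : j ≤ a ∧ j ≤ b
  swap
  · rw [Finset.sum_eq_zero, Finset.sum_eq_zero]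
    · intro μ hμ
      rw [mem_diagramsOfCard] at hμ
      by_cases ha : j ≤ a
      · rw [fSkew_eq_zero_of_lt (by omega), zero_mul]
      · rw [fSkew_eq_zero_of_lt (l := α) (by omega), mul_zero]
    · intro st hst
      obtain ⟨ha, hb, -⟩ := mem_j2Set.1 (Finset.mem_filter.1 hst).2.2.2
      exact absurd ⟨ha, hb⟩ hj
  obtain ⟨ha, hb⟩ := hj
  have hrhs : ∑ μ ∈ diagramsOfCard j, fSkew μ β (b - j) p * fSkew μ α (a - j) q =
      ∑ x ∈ (diagramsOfCard j).sigma fun μ => skewSYT μ β (b - j) ×ˢ skewSYT μ α (a - j),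
        p ^ chainMaj x.2.1 * q ^ chainMaj x.2.2 := by
    rw [Finset.sum_sigma]
    refine Finset.sum_congr rfl fun μ _ => ?_
    rw [fSkew, fSkew, Finset.sum_mul_sum, Finset.sum_product]
  have hmem : ∀ st : Equiv.Perm (Fin a) × Equiv.Perm (Fin b),
      st ∈ Finset.univ.filter (fun st : Equiv.Perm (Fin a) × Equiv.Perm (Fin b) =>
        Pchain st.1 = A ∧ Qchain st.2 = B ∧ j ∈ j2Set st.1 st.2) ↔
      Pchain st.1 = A ∧ Pchain st.2⁻¹ = B ∧ pInit st.1 j ha = (pInit st.2⁻¹ j hb)⁻¹ := by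
    intro st
    simp [hB', mem_j2Set, vLow, ha, hb]
  rw [hrhs]
  refine Finset.sum_bij (fun st _ => ⟨Qchain (pInit st.1 j ha) (Fin.last j),
    (tailChain (Qchain st.2⁻¹) j, tailChain (Qchain st.1) j)⟩) ?_ ?_ ?_ ?_
  · rintro ⟨σ, τ⟩ hst
    obtain ⟨rfl, rfl, h⟩ := (hmem _).1 hst
    rw [Finset.mem_sigma, mem_diagramsOfCard, Finset.mem_product]
    refine ⟨card_Qchain_last _, ?_, tailChain_Qchain_mem_skewSYT ha hA⟩
    have := tailChain_Qchain_mem_skewSYT hb hB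
    rwa [← Pchain_last, ← inv_inv (pInit τ⁻¹ j hb), ← h, Pchain_inv] at this
  · rintro ⟨σ, τ⟩ h ⟨σ', τ'⟩ h' heq
    obtain ⟨hσ, hτ, h⟩ := (hmem _).1 h
    obtain ⟨hσ', hτ', h'⟩ := (hmem _).1 h'
    obtain ⟨-, heq⟩ := Sigma.mk.inj_iff.1 heq
    obtain ⟨hV, hU⟩ := Prod.mk.inj (eq_of_heq heq)
    have hPσ := hσ.trans hσ'.symm
    have hPτ := hτ.trans hτ'.symm
    have hinit := pInit_eq_of_Pchain_eq ha hb h h' (Pchain_pInit_congr ha hPσ hU)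
      (Pchain_pInit_congr hb hPτ hV)
    have h1 := eq_of_tailChain_Qchain_eq ha hPσ hU hinit
    have h2 := eq_of_tailChain_Qchain_eq hb hPτ hV (inv_injective (h.symm.trans (hinit.trans h')))
    exact Prod.ext h1 (inv_injective h2)
  · rintro ⟨μ, V, U⟩ h
    rw [Finset.mem_sigma, mem_diagramsOfCard, Finset.mem_product] at h
    obtain ⟨hμ, hV, hU⟩ := h
    obtain ⟨σ, τ, hσ, hτ, rfl, rfl, h⟩ := exists_pInit_eq_inv ha hb hμ hA hB hU hV
    refine ⟨(σ, τ⁻¹), (hmem _).2 ⟨hσ, by rwa [inv_inv], by rwa [inv_inv]⟩, ?_⟩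
    have hstart : Qchain (pInit σ j ha) (Fin.last j) = μ := by
      subst hσ
      exact (mem_skewSYT.1 (tailChain_Qchain_mem_skewSYT ha hA)).1.symm.trans (mem_skewSYT.1 hU).1
    simp [hstart]
  · rintro ⟨σ, τ⟩ -
    rw [imaj_vHigh hb, maj_pTail ha]

end QT
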